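/- arXiv:math/0110146 — 3 statements merged into one kernel-verified Lean document; each statement's English description precedes it below -/
import Mathlib

section
/- A separable infinite-dimensional real Banach space X is reflexive if and only if there exists an equivalent norm ||||·|||| on X such that every asymptotic model (e_n)_{n∈ω} of (X, ||||·||||) satisfies ||||e_0 + e_1|||| < 2 (i.e., ‖e_0 + e_1‖_E < 2 in the asymptotic model's norm). -/
open Filter Finset Topology

variable {X : Type*} [NormedAddCommGroup X] [NormedSpace ℝ X]
variable {E : Type*} [NormedAddCommGroup E] [NormedSpace ℝ E]

/-- `(x i)` is a `C`-basic sequence. -/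
def IsCBasic (C : ℝ) (x : ℕ → X) : Prop :=
  (∀ i, x i ≠ 0) ∧
    ∀ n m : ℕ, n < m → ∀ a : ℕ → ℝ,
      ‖∑ i ∈ Finset.range n, a i • x i‖ ≤ C * ‖∑ i ∈ Finset.range m, a i • x i‖

/-- The finite sequence `y 0, …, y (m-1)` is `C`-basic. -/
def IsCBasicUpTo (C : ℝ) (m : ℕ) (y : ℕ → X) : Prop :=
  (∀ j, j < m → y j ≠ 0) ∧
    ∀ n k : ℕ, n < k → k ≤ m → ∀ a : ℕ → ℝ,
      ‖∑ i ∈ Finset.range n, a i • y i‖ ≤ C * ‖∑ i ∈ Finset.range k, a i • y i‖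

/-- `(x i)` is normalized. -/
def Normalized (x : ℕ → X) : Prop := ∀ i, ‖x i‖ = 1

/-- `x` is a `K`-basic array: each row `x n` is a normalized `K`-basic sequence and every
"diagonal" sequence `(x j (i j))_{j<m}` with `m ≤ i 0 < i 1 < ⋯` is `K`-basic. -/
def IsBasicArrayWith (K : ℝ) (x : ℕ → ℕ → X) : Prop :=
  (∀ n, Normalized (x n) ∧ IsCBasic K (x n)) ∧
    ∀ (m : ℕ) (i : ℕ → ℕ), StrictMono i → m ≤ i 0 →
      IsCBasicUpTo K m fun j => x j (i j)

/-- `x` is a basic array if it is a `K`-basic array for some `K`. -/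
def IsBasicArray (x : ℕ → ℕ → X) : Prop := ∃ K : ℝ, IsBasicArrayWith K x

/-- `IteratedLimit n f L`: the iterated limit `lim_{i₀→∞} ⋯ lim_{i_{n-1}→∞} f (i₀, …, i_{n-1})`
exists and equals `L`. -/
def IteratedLimit : ∀ n : ℕ, ((Fin n → ℕ) → ℝ) → ℝ → Prop
  | 0, f, L => f (fun i => i.elim0) = L
  | n + 1, f, L => ∃ g : ℕ → ℝ,
      (∀ i₀ : ℕ, IteratedLimit n (fun t => f (Fin.cons i₀ t)) (g i₀)) ∧
      Filter.Tendsto g Filter.atTop (nhds L)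

/-- `(x i)` is a `C`-basic sequence with respect to the norm function `ν`. -/
def IsCBasicW (ν : X → ℝ) (C : ℝ) (x : ℕ → X) : Prop :=
  (∀ i, x i ≠ 0) ∧
    ∀ n m : ℕ, n < m → ∀ a : ℕ → ℝ,
      ν (∑ i ∈ Finset.range n, a i • x i) ≤ C * ν (∑ i ∈ Finset.range m, a i • x i)

/-- The finite sequence `y 0, …, y (m-1)` is `C`-basic with respect to `ν`. -/
def IsCBasicUpToW (ν : X → ℝ) (C : ℝ) (m : ℕ) (y : ℕ → X) : Prop :=
  (∀ j, j < m → y j ≠ 0) ∧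
    ∀ n k : ℕ, n < k → k ≤ m → ∀ a : ℕ → ℝ,
      ν (∑ i ∈ Finset.range n, a i • y i) ≤ C * ν (∑ i ∈ Finset.range k, a i • y i)

/-- `(x i)` is normalized with respect to `ν`. -/
def NormalizedW (ν : X → ℝ) (x : ℕ → X) : Prop := ∀ i, ν (x i) = 1

/-- `x` is a `K`-basic array with respect to `ν`. -/
def IsBasicArrayWithW (ν : X → ℝ) (K : ℝ) (x : ℕ → ℕ → X) : Prop :=
  (∀ n, NormalizedW ν (x n) ∧ IsCBasicW ν K (x n)) ∧
    ∀ (m : ℕ) (i : ℕ → ℕ), StrictMono i → m ≤ i 0 →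
      IsCBasicUpToW ν K m fun j => x j (i j)

/-- `x` is a basic array with respect to `ν`. -/
def IsBasicArrayW (ν : X → ℝ) (x : ℕ → ℕ → X) : Prop := ∃ K : ℝ, IsBasicArrayWithW ν K x

/-- `IterLim2 F L`: the iterated limit `lim_{m→∞} lim_{n→∞} F m n` exists and equals `L`. -/
def IterLim2 (F : ℕ → ℕ → ℝ) (L : ℝ) : Prop :=
  ∃ g : ℕ → ℝ, (∀ m, Filter.Tendsto (fun n => F m n) Filter.atTop (nhds (g m))) ∧
    Filter.Tendsto g Filter.atTop (nhds L)

/-- An equivalent norm on `X`: a subadditive, absolutely homogeneous functional which is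
equivalent to the original norm. -/
structure EquivNorm (X : Type*) [NormedAddCommGroup X] [NormedSpace ℝ X] where
  toFun : X → ℝ
  add_le' : ∀ x y : X, toFun (x + y) ≤ toFun x + toFun y
  smul' : ∀ (a : ℝ) (x : X), toFun (a • x) = |a| * toFun x
  lower' : ∃ A : ℝ, 0 < A ∧ ∀ x : X, A * ‖x‖ ≤ toFun x
  upper' : ∃ B : ℝ, 0 < B ∧ ∀ x : X, toFun x ≤ B * ‖x‖

/-- The array `y` in `X` (with norm function `ν`) generates the asymptotic model `e`. -/
def GeneratesAsymptoticModelW (ν : X → ℝ) (y : ℕ → ℕ → X) (e : ℕ → E) : Prop :=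
  ∀ (n : ℕ) (b : ℕ → ℝ),
    IteratedLimit n (fun t => ν (∑ j : Fin n, b (j : ℕ) • y (j : ℕ) (t j)))
      ‖∑ j ∈ Finset.range n, b j • e j‖

/-- `e` is an asymptotic model of `(X, ν)`. -/
def IsAsymptoticModelW (ν : X → ℝ) {E : Type*} [NormedAddCommGroup E] [NormedSpace ℝ E]
    (e : ℕ → E) : Prop :=
  Normalized e ∧ (∃ C : ℝ, IsCBasic C e) ∧
    ∃ y : ℕ → ℕ → X, IsBasicArrayW ν y ∧ GeneratesAsymptoticModelW ν y e

/-- A Banach space is reflexive if the canonical inclusion into its double dual is onto. -/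
def IsReflexive (Z : Type*) [NormedAddCommGroup Z] [NormedSpace ℝ Z] : Prop :=
  Function.Surjective ⇑(NormedSpace.inclusionInDoubleDual ℝ Z)

section UltraLimit

/-- The limit of a bounded real sequence along a fixed nonprincipal ultrafilter. -/
noncomputable def ultraLim (f : ℕ → ℝ) : ℝ := limUnder (hyperfilter ℕ : Filter ℕ) f

lemma tendsto_ultraLim {f : ℕ → ℝ} {C : ℝ} (h : ∀ i, |f i| ≤ C) :
    Tendsto f (hyperfilter ℕ) (𝓝 (ultraLim f)) := by
  obtain ⟨L, -, hL⟩ := (isCompact_Icc (a := -C) (b := C)).ultrafilter_le_nhds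
    ((hyperfilter ℕ).map f) (by
      rw [le_principal_iff]
      exact Filter.mem_map.2 (Filter.univ_mem' fun i => abs_le.1 (h i)))
  exact tendsto_nhds_limUnder ⟨L, hL⟩

lemma ultraLim_eq {f : ℕ → ℝ} {L : ℝ} (h : Tendsto f (hyperfilter ℕ) (𝓝 L)) : ultraLim f = L :=
  h.limUnder_eq

@[simp] lemma ultraLim_const (c : ℝ) : ultraLim (fun _ => c) = c :=
  ultraLim_eq tendsto_const_nhds

lemma Filter.Tendsto.hyperfilter {f : ℕ → ℝ} {L : ℝ} (h : Tendsto f atTop (𝓝 L)) :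
    Tendsto f (Filter.hyperfilter ℕ) (𝓝 L) :=
  h.mono_left Nat.hyperfilter_le_atTop

end UltraLimit

section CompactUniform

/-- Pointwise eventual lower bounds for a family of functions that are uniformly lower
semicontinuous hold uniformly on compact sets. -/
lemma IsCompact.eventually_forall_lt {α ι : Type*} [TopologicalSpace α] {S : Set α}
    (hS : IsCompact S) {l : Filter ι} {Φ : ι → α → ℝ} {θ : ℝ}
    (hΦ : ∀ p ∈ S, ∃ g : α → ℝ, Tendsto g (𝓝[S] p) (𝓝 0) ∧ ∀ m, ∀ q ∈ S, Φ m p ≤ Φ m q + g q)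
    (hθ : ∀ p ∈ S, ∃ η > θ, ∀ᶠ m in l, η < Φ m p) :
    ∀ᶠ m in l, ∀ p ∈ S, θ < Φ m p := by
  refine hS.induction_on (p := fun T => ∀ᶠ m in l, ∀ p ∈ T, p ∈ S → θ < Φ m p) ?_ ?_ ?_ ?_ |>.mono
    fun m hm p hp => hm p hp hp
  · simp
  · intro s t hst h
    exact h.mono fun m hm p hp => hm p (hst hp)
  · intro s t hs ht
    filter_upwards [hs, ht] with m h1 h2 p hp hpS
    exact hp.elim (fun h => h1 p h hpS) (fun h => h2 p h hpS)
  · intro p hp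
    obtain ⟨g, hg, hgΦ⟩ := hΦ p hp
    obtain ⟨η, hη, hm⟩ := hθ p hp
    refine ⟨{q | g q < η - θ}, hg.eventually_lt_const (by linarith), ?_⟩
    filter_upwards [hm] with m hm q hq hqS
    have := hgΦ m q hqS
    have hq' : g q < η - θ := hq
    linarith

end CompactUniform

section TypeLimit

/-- The type of a sequence: the limit of `‖z + x k‖` along the ultrafilter. -/
noncomputable def typeLim (x : ℕ → X) (z : X) : ℝ := ultraLim fun k => ‖z + x k‖

variable {x : ℕ → X} {M : ℝ}

lemma tendsto_typeLim (hx : ∀ k, ‖x k‖ ≤ M) (z : X) :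
    Tendsto (fun k => ‖z + x k‖) (hyperfilter ℕ) (𝓝 (typeLim x z)) := by
  refine tendsto_ultraLim (C := ‖z‖ + M) fun k => ?_
  rw [abs_norm]
  exact (norm_add_le _ _).trans (by gcongr; exact hx k)

lemma smul_bound (hx : ∀ k, ‖x k‖ ≤ M) (a : ℝ) (k : ℕ) : ‖a • x k‖ ≤ |a| * M := by
  rw [norm_smul, Real.norm_eq_abs]
  exact mul_le_mul_of_nonneg_left (hx k) (abs_nonneg a)

lemma typeLim_le_add (hx : ∀ k, ‖x k‖ ≤ M) (a b : ℝ) (z w : X) :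
    typeLim (fun k => a • x k) z ≤ typeLim (fun k => b • x k) w + (‖z - w‖ + |a - b| * M) := by
  refine le_of_tendsto_of_tendsto' (tendsto_typeLim (smul_bound hx a) z)
    ((tendsto_typeLim (smul_bound hx b) w).add_const _) fun k => ?_
  calc ‖z + a • x k‖ = ‖(w + b • x k) + ((z - w) + (a - b) • x k)‖ := by
        congr 1; module
    _ ≤ ‖w + b • x k‖ + (‖z - w‖ + ‖(a - b) • x k‖) :=
        (norm_add_le _ _).trans (by gcongr; exact norm_add_le _ _)
    _ ≤ _ := by gcongr; exact smul_bound hx _ k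

lemma typeLim_le_add' (hx : ∀ k, ‖x k‖ ≤ M) (z w : X) :
    typeLim x z ≤ typeLim x w + ‖z - w‖ := by
  simpa using typeLim_le_add hx 1 1 z w

lemma abs_typeLim_le (hx : ∀ k, ‖x k‖ ≤ M) (z : X) : |typeLim x z| ≤ ‖z‖ + M := by
  have h := tendsto_typeLim hx z
  rw [abs_of_nonneg (ge_of_tendsto' h fun k => norm_nonneg _)]
  exact le_of_tendsto' h fun k => (norm_add_le _ _).trans (by gcongr; exact hx k)

lemma tendsto_typeLim_typeLim {y : ℕ → X} {M' : ℝ} (hx : ∀ k, ‖x k‖ ≤ M) (hy : ∀ k, ‖y k‖ ≤ M')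
    (z : X) : Tendsto (fun m => typeLim y (z + x m)) (hyperfilter ℕ)
      (𝓝 (ultraLim fun m => typeLim y (z + x m))) := by
  refine tendsto_ultraLim (C := ‖z‖ + M + M') fun m => (abs_typeLim_le hy _).trans ?_
  gcongr
  exact (norm_add_le _ _).trans (by gcongr; exact hx m)

lemma typeLim_smul (hx : ∀ k, ‖x k‖ ≤ M) {r : ℝ} (hr : 0 < r) (z : X) :
    typeLim (fun k => r • x k) z = r * typeLim x (r⁻¹ • z) := by
  refine ultraLim_eq (((tendsto_typeLim hx (r⁻¹ • z)).const_mul r).congr fun k => ?_)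
  rw [← abs_of_pos hr, ← Real.norm_eq_abs, ← norm_smul, Real.norm_eq_abs, abs_of_pos hr]
  congr 1
  rw [smul_add, smul_smul, mul_inv_cancel₀ hr.ne', one_smul]

@[simp] lemma typeLim_zero (z : X) : typeLim (fun _ => (0 : X)) z = ‖z‖ := by
  simp [typeLim]

/-- If the type of `x` satisfies the midpoint additivity `σ ∗ σ (2 z) = 2 σ z`, then weighted sums
of two far out terms behave as a multiple of a single term. -/
lemma eventually_lt_typeLim_add (hx : ∀ k, ‖x k‖ ≤ M)
    (hadd : ∀ z, 2 * typeLim x z ≤ ultraLim fun m => typeLim x ((2 : ℝ) • z + x m))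
    {a b : ℝ} (ha : 0 ≤ a) (hb : 0 ≤ b) (z : X) {θ : ℝ}
    (hθ : θ < typeLim (fun k => (a + b) • x k) z) :
    ∀ᶠ m in (hyperfilter ℕ : Filter ℕ), θ < typeLim (fun k => a • x k) (z + b • x m) := by
  rcases (add_nonneg ha hb).eq_or_lt with h0 | hr
  · obtain rfl : a = 0 := by linarith
    obtain rfl : b = 0 := by linarith
    simpa using hθ
  set r := a + b with hr_def
  set w := r⁻¹ • z with hw
  have hz : z = r • w := by rw [hw, smul_smul, mul_inv_cancel₀ hr.ne', one_smul]
  rw [typeLim_smul hx hr, ← hw] at hθ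
  have hσ := tendsto_typeLim hx w
  have hσσ := tendsto_typeLim_typeLim hx hx ((2 : ℝ) • w)
  have h2 := hadd w
  set σ := typeLim x w
  set κ := ultraLim fun m => typeLim x ((2 : ℝ) • w + x m)
  rcases le_total b a with hba | hab
  · have hlow : ∀ m, a * typeLim x ((2 : ℝ) • w + x m) - (a - b) * ‖w + x m‖ ≤
        typeLim (fun k => a • x k) (z + b • x m) := fun m => by
      refine le_of_tendsto_of_tendsto'
        (((tendsto_typeLim hx ((2 : ℝ) • w + x m)).const_mul a).sub_const _)
        (tendsto_typeLim (smul_bound hx a) (z + b • x m)) fun k => ?_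
      have e : a • ((2 : ℝ) • w + x m + x k) = (z + b • x m + a • x k) + (a - b) • (w + x m) := by
        rw [hz, hr_def]; module
      have h := norm_add_le (z + b • x m + a • x k) ((a - b) • (w + x m))
      rw [← e, norm_smul, norm_smul, Real.norm_of_nonneg ha,
        Real.norm_of_nonneg (sub_nonneg.2 hba)] at h
      linarith
    have hlim := (hσσ.const_mul a).sub (hσ.const_mul (a - b))
    refine (hlim.eventually_const_lt (u := θ) ?_).mono fun m hm => hm.trans_le (hlow m)
    nlinarith
  · have hlow : ∀ m, b * typeLim x ((2 : ℝ) • w + x m) - (b - a) * σ ≤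
        typeLim (fun k => a • x k) (z + b • x m) := fun m => by
      refine le_of_tendsto_of_tendsto'
        (((tendsto_typeLim hx ((2 : ℝ) • w + x m)).const_mul b).sub (hσ.const_mul (b - a)))
        (tendsto_typeLim (smul_bound hx a) (z + b • x m)) fun k => ?_
      have e : b • ((2 : ℝ) • w + x m + x k) = (z + b • x m + a • x k) + (b - a) • (w + x k) := by
        rw [hz, hr_def]; module
      have h := norm_add_le (z + b • x m + a • x k) ((b - a) • (w + x k))
      rw [← e, norm_smul, norm_smul, Real.norm_of_nonneg hb,
        Real.norm_of_nonneg (sub_nonneg.2 hab)] at h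
      linarith
    have hlim := (hσσ.const_mul b).sub_const ((b - a) * σ)
    refine (hlim.eventually_const_lt (u := θ) ?_).mono fun m hm => hm.trans_le (hlow m)
    nlinarith

lemma eventually_forall_lt_typeLim (hx : ∀ k, ‖x k‖ ≤ M)
    (hadd : ∀ z, 2 * typeLim x z ≤ ultraLim fun m => typeLim x ((2 : ℝ) • z + x m))
    {S : Set (X × ℝ × ℝ)} (hS : IsCompact S) {θ : ℝ}
    (hS01 : ∀ p ∈ S, p.2.1 ∈ Set.Icc (0 : ℝ) 1 ∧ p.2.2 ∈ Set.Icc (0 : ℝ) 1)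
    (hθ : ∀ p ∈ S, θ < typeLim (fun k => (p.2.1 + (1 - p.2.1) * p.2.2) • x k)
      (((1 - p.2.1) * (1 - p.2.2)) • p.1)) :
    ∀ᶠ m in (hyperfilter ℕ : Filter ℕ), ∀ p ∈ S,
      θ < typeLim (fun k => p.2.1 • x k)
        (((1 - p.2.1) * (1 - p.2.2)) • p.1 + ((1 - p.2.1) * p.2.2) • x m) := by
  refine hS.eventually_forall_lt ?_ ?_
  · intro p hp
    refine ⟨fun q => ‖((1 - p.2.1) * (1 - p.2.2)) • p.1 - ((1 - q.2.1) * (1 - q.2.2)) • q.1‖ +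
      |(1 - p.2.1) * p.2.2 - (1 - q.2.1) * q.2.2| * M + |p.2.1 - q.2.1| * M, ?_, ?_⟩
    · refine tendsto_nhdsWithin_of_tendsto_nhds ?_
      have hc : Continuous fun q : X × ℝ × ℝ =>
          ‖((1 - p.2.1) * (1 - p.2.2)) • p.1 - ((1 - q.2.1) * (1 - q.2.2)) • q.1‖ +
          |(1 - p.2.1) * p.2.2 - (1 - q.2.1) * q.2.2| * M + |p.2.1 - q.2.1| * M := by fun_prop
      simpa using hc.tendsto p
    · intro m q _
      refine (typeLim_le_add hx p.2.1 q.2.1 _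
        (((1 - q.2.1) * (1 - q.2.2)) • q.1 + ((1 - q.2.1) * q.2.2) • x m)).trans ?_
      beta_reduce
      gcongr
      rw [add_sub_add_comm, ← sub_smul]
      exact (norm_add_le _ _).trans (by gcongr; exact smul_bound hx _ m)
  · intro p hp
    obtain ⟨η, h1, h2⟩ := exists_between (hθ p hp)
    obtain ⟨⟨h3, h4⟩, h5, h6⟩ := hS01 p hp
    exact ⟨η, h1, eventually_lt_typeLim_add hx hadd h3 (mul_nonneg (by linarith) h5) _ h2⟩

/-- A sequence whose type has the midpoint additivity property and does not vanish at `0` is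
not weakly null. -/
theorem exists_functional_frequently_le (hx : ∀ k, ‖x k‖ ≤ M)
    (hadd : ∀ z, 2 * typeLim x z ≤ ultraLim fun m => typeLim x ((2 : ℝ) • z + x m))
    (h0 : 0 < typeLim x 0) :
    ∃ f : X →L[ℝ] ℝ, ∃ u > 0, ∃ᶠ m in atTop, u ≤ f (x m) := by
  obtain ⟨θ, hθ0, hθ⟩ := exists_between h0
  let good : Set X → Prop := fun D => IsCompact D ∧ Convex ℝ D ∧ D.Nonempty ∧
    ∀ w ∈ D, ∀ t ∈ Set.Icc (0 : ℝ) 1, θ < typeLim (fun k => t • x k) ((1 - t) • w)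
  have hbase : ∃ D, good D := by
    have h := eventually_forall_lt_typeLim hx hadd (θ := θ)
      (S := ({(0 : X)} : Set X) ×ˢ (Set.Icc (0 : ℝ) 1 ×ˢ ({1} : Set ℝ)))
      (isCompact_singleton.prod (isCompact_Icc.prod isCompact_singleton))
      (by rintro ⟨w, t, s⟩ ⟨-, ht, rfl⟩; exact ⟨ht, by simp⟩)
      (by rintro ⟨w, t, s⟩ ⟨-, ht, rfl⟩; simpa using hθ)
    obtain ⟨m, hm⟩ := h.exists
    refine ⟨{x m}, isCompact_singleton, convex_singleton _, Set.singleton_nonempty _, ?_⟩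
    rintro w rfl t ht
    simpa using hm (0, t, 1) ⟨rfl, ht, rfl⟩
  have hstep : ∀ n D, good D → ∃ D', good D' ∧ D ⊆ D' ∧ ∃ m, n ≤ m ∧ x m ∈ D' := by
    rintro n D ⟨hc, hconv, hne, hD⟩
    have h := eventually_forall_lt_typeLim hx hadd (θ := θ)
      (S := D ×ˢ (Set.Icc (0 : ℝ) 1 ×ˢ Set.Icc (0 : ℝ) 1))
      (hc.prod (isCompact_Icc.prod isCompact_Icc))
      (by rintro ⟨w, t, s⟩ ⟨-, ht, hs⟩; exact ⟨ht, hs⟩)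
      (by
        rintro ⟨w, t, s⟩ ⟨hw, ⟨ht0, ht1⟩, hs0, hs1⟩
        have := hD w hw (t + (1 - t) * s) ⟨by nlinarith, by nlinarith⟩
        convert this using 2
        ring_nf)
    obtain ⟨m, hm, hnm⟩ := (h.and (Nat.hyperfilter_le_atTop (eventually_ge_atTop n))).exists
    refine ⟨(fun p : X × ℝ => (1 - p.2) • p.1 + p.2 • x m) '' (D ×ˢ Set.Icc (0 : ℝ) 1),
      ⟨?_, ?_, ?_, ?_⟩, ?_, m, hnm, ?_⟩
    · exact (hc.prod isCompact_Icc).image (by fun_prop)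
    · have : (fun p : X × ℝ => (1 - p.2) • p.1 + p.2 • x m) '' (D ×ˢ Set.Icc (0 : ℝ) 1) =
          convexJoin ℝ D {x m} := by
        ext v
        simp only [Set.mem_image, Set.mem_prod, Prod.exists, convexJoin_singleton_right,
          Set.mem_iUnion, exists_prop]
        constructor
        · rintro ⟨w, t, ⟨hw, ht⟩, rfl⟩
          exact ⟨w, hw, 1 - t, t, by linarith [ht.2], ht.1, by ring, rfl⟩
        · rintro ⟨w, hw, a, b, ha, hb, hab, rfl⟩
          obtain rfl : a = 1 - b := by linarith
          exact ⟨w, b, ⟨hw, hb, by linarith⟩, rfl⟩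
      rw [this]
      exact hconv.convexJoin (convex_singleton _)
    · exact (hne.prod ⟨0, by simp⟩).image _
    · rintro _ ⟨⟨w, s⟩, ⟨hw, hs⟩, rfl⟩ t ht
      convert hm (w, t, s) ⟨hw, ht, hs⟩ using 2
      simp only [smul_add, smul_smul]
    · intro w hw
      exact ⟨(w, 0), ⟨hw, by simp⟩, by simp⟩
    · obtain ⟨w, hw⟩ := hne
      exact ⟨(w, 1), ⟨hw, by simp⟩, by simp⟩
  obtain ⟨D₀, hD₀⟩ := hbase
  choose! next hgood hsub hmem using hstep
  let D : ℕ → Set X := fun n => Nat.rec D₀ next n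
  have hDgood : ∀ n, good (D n) := fun n => by
    induction n with
    | zero => exact hD₀
    | succ n ih => exact hgood n _ ih
  have hmono : Monotone D := monotone_nat_of_le_succ fun n => hsub n _ (hDgood n)
  have hdisj : Disjoint (Metric.ball (0 : X) θ) (⋃ n, D n) := by
    rw [Set.disjoint_left]
    rintro w hw hwD
    obtain ⟨n, hn⟩ := Set.mem_iUnion.1 hwD
    have := (hDgood n).2.2.2 w hn 0 (by simp)
    simp only [zero_smul, typeLim_zero, sub_zero, one_smul] at this
    rw [mem_ball_zero_iff] at hw
    linarith
  obtain ⟨f, u, hf1, hf2⟩ := geometric_hahn_banach_open (convex_ball (0 : X) θ) Metric.isOpen_ball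
    (hmono.directed_le.convex_iUnion fun n => (hDgood n).2.1) hdisj
  refine ⟨f, u, by simpa using hf1 0 (by simpa using hθ0), frequently_atTop.2 fun n => ?_⟩
  obtain ⟨m, hnm, hm⟩ := hmem n (D n) (hDgood n)
  exact ⟨m, hnm, hf2 _ (Set.mem_iUnion.2 ⟨n + 1, hm⟩)⟩

end TypeLimit

namespace EquivNorm

variable (N : EquivNorm X)

lemma nonneg (x : X) : 0 ≤ N.toFun x := by
  obtain ⟨A, hA, h⟩ := N.lower'
  exact (by positivity : 0 ≤ A * ‖x‖).trans (h x)

lemma map_zero : N.toFun 0 = 0 := by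
  simpa using N.smul' 0 0

lemma map_neg (x : X) : N.toFun (-x) = N.toFun x := by
  simpa using N.smul' (-1) x

lemma eq_zero {x : X} (h : N.toFun x = 0) : x = 0 := by
  obtain ⟨A, hA, hl⟩ := N.lower'
  have := hl x
  rw [h] at this
  exact norm_le_zero_iff.1 (by nlinarith [norm_nonneg x])

end EquivNorm

lemma exists_sum_range_of_mem_range_linearCombination {x : ℕ → X} {v : X}
    (hv : v ∈ LinearMap.range (Finsupp.linearCombination ℝ x)) :
    ∃ (m : ℕ) (a : ℕ → ℝ), v = ∑ i ∈ Finset.range m, a i • x i := by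
  obtain ⟨a, rfl⟩ := hv
  obtain ⟨m, hm⟩ := a.support.exists_nat_subset_range
  refine ⟨m, a, ?_⟩
  rw [Finsupp.linearCombination_apply, Finsupp.sum_of_support_subset a hm _ (by simp)]

/-- A normalized basic sequence in a reflexive space is weakly null: no functional is bounded below
by a positive number on infinitely many terms. -/
theorem IsReflexive.not_frequently_le (hX : IsReflexive X) (N : EquivNorm X) {K : ℝ} {x : ℕ → X}
    (hn : NormalizedW N.toFun x) (hx : IsCBasicW N.toFun K x) (f : X →L[ℝ] ℝ) {u : ℝ}
    (hu : 0 < u) : ¬ ∃ᶠ m in atTop, u ≤ f (x m) := by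
  intro hfreq
  obtain ⟨A, hA, hlow⟩ := N.lower'
  obtain ⟨B, hB, hup⟩ := N.upper'
  have hbd : ∀ i, ‖x i‖ ≤ A⁻¹ := fun i => by
    have := hlow (x i)
    rw [hn i] at this
    rw [← one_div, le_div_iff₀ hA]
    linarith
  obtain ⟨φ, hφ, hφu⟩ := extraction_of_frequently_atTop hfreq
  have hbdg : ∀ (g : StrongDual ℝ X) (i : ℕ), |g (x (φ i))| ≤ A⁻¹ * ‖g‖ := fun g i => by
    rw [← Real.norm_eq_abs, mul_comm]
    exact g.le_opNorm_of_le (hbd _)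
  have hlim := fun g : StrongDual ℝ X => tendsto_ultraLim (hbdg g)
  let Φ : StrongDual ℝ (StrongDual ℝ X) := LinearMap.mkContinuous
    { toFun := fun g => ultraLim fun i => g (x (φ i))
      map_add' := fun g h => ultraLim_eq ((hlim g).add (hlim h))
      map_smul' := fun c g => ultraLim_eq ((hlim g).const_mul c) } A⁻¹ fun g => by
        rw [Real.norm_eq_abs]
        exact le_of_tendsto' (hlim g).abs (hbdg g)
  obtain ⟨w, hw⟩ := hX Φ
  have hwg : ∀ g : StrongDual ℝ X, Tendsto (fun i => g (x (φ i))) (hyperfilter ℕ) (𝓝 (g w)) :=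
    fun g => by
      have : g w = ultraLim fun i => g (x (φ i)) := by
        have := DFunLike.congr_fun hw g
        exact this
      rw [this]; exact hlim g
  have hfw : u ≤ f w := ge_of_tendsto' (hwg f) hφu
  let T : ℕ → Submodule ℝ X := fun n =>
    LinearMap.range (Finsupp.linearCombination ℝ fun i => x (n + i))
  have hmem : ∀ n, w ∈ closure (T n : Set X) := by
    intro n
    by_contra hc
    obtain ⟨g, v, hg, hv⟩ := geometric_hahn_banach_closed_point (T n).convex.closure
      isClosed_closure hc
    have hev : ∀ᶠ i in (hyperfilter ℕ : Filter ℕ), g (x (φ i)) ≤ v := by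
      refine Nat.hyperfilter_le_atTop ((eventually_ge_atTop n).mono fun i hi => ?_)
      refine (hg _ (subset_closure ⟨Finsupp.single (φ i - n) 1, ?_⟩)).le
      have := hφ.le_apply (x := i)
      simp [Nat.add_sub_cancel' (hi.trans this)]
    exact absurd (le_of_tendsto (hwg g) hev) (not_le.2 hv)
  have hKB : ∀ ε > 0, A * ‖w‖ ≤ (2 * |K| * B + A) * ε := by
    intro ε hε
    obtain ⟨p, hp, hpw⟩ := Metric.mem_closure_iff.1 (hmem 0) ε hε
    simp only [T, zero_add] at hp
    obtain ⟨n, a, rfl⟩ := exists_sum_range_of_mem_range_linearCombination hp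
    obtain ⟨q, hq, hqw⟩ := Metric.mem_closure_iff.1 (hmem n) ε hε
    obtain ⟨m, b, rfl⟩ := exists_sum_range_of_mem_range_linearCombination hq
    have hb := hx.2 n (n + (m + 1)) (by omega)
      (fun i => if i < n then a i else if i - n < m then - b (i - n) else 0)
    rw [Finset.sum_range_add] at hb
    have e1 : ∑ i ∈ Finset.range n,
        (if i < n then a i else if i - n < m then - b (i - n) else 0) • x i =
        ∑ i ∈ Finset.range n, a i • x i :=
      Finset.sum_congr rfl fun i hi => by rw [if_pos (Finset.mem_range.1 hi)]
    have e2 : ∑ i ∈ Finset.range (m + 1), (if n + i < n then a (n + i) else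
        if n + i - n < m then - b (n + i - n) else 0) • x (n + i) =
        - ∑ i ∈ Finset.range m, b i • x (n + i) := by
      rw [Finset.sum_range_succ, ← Finset.sum_neg_distrib]
      simp only [add_lt_iff_neg_left, not_lt_zero, if_false, add_tsub_cancel_left, lt_irrefl,
        zero_smul, add_zero]
      exact Finset.sum_congr rfl fun i hi => by rw [if_pos (Finset.mem_range.1 hi), neg_smul]
    rw [e1, e2] at hb
    set p := ∑ i ∈ Finset.range n, a i • x i
    set q := ∑ i ∈ Finset.range m, b i • x (n + i)
    rw [dist_eq_norm] at hpw hqw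
    have h1 : ‖w‖ ≤ ‖p‖ + ε := by
      have := norm_add_le p (w - p)
      rw [add_sub_cancel] at this
      linarith
    have h2 : ‖p + -q‖ ≤ 2 * ε := by
      have := norm_sub_le (w - q) (w - p)
      rw [sub_sub_sub_cancel_left, ← sub_eq_add_neg] at *
      linarith
    have h3 := hup (p + -q)
    have h4 := hlow p
    have h5 : K * N.toFun (p + -q) ≤ |K| * (B * (2 * ε)) :=
      mul_le_mul (le_abs_self K) (h3.trans (by gcongr)) (N.nonneg _) (abs_nonneg K)
    nlinarith
  have hw0 : ‖w‖ ≤ 0 := by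
    by_contra! hpos
    have hC : 0 < 2 * |K| * B + A := by positivity
    have := hKB (A * ‖w‖ / (2 * (2 * |K| * B + A))) (by positivity)
    rw [mul_div_assoc', mul_comm (2 * |K| * B + A), mul_div_mul_right _ _ hC.ne'] at this
    nlinarith [mul_pos hA hpos]
  rw [norm_le_zero_iff.1 hw0, _root_.map_zero] at hfw
  linarith

section Renorming

variable (c : ℕ → X)

/-- The summands of the squared renorming attached to a sequence of centres. -/
noncomputable def renormTerm (t : ℝ) (x : X) (i : ℕ) : ℝ :=
  ((1 / 2) ^ i / (1 + ‖c i‖) ^ 2) * (‖t • c i + x‖ ^ 2 + ‖t • c i - x‖ ^ 2)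

/-- The squared renorming, with the scale of the centres as a separate variable. -/
noncomputable def renormSq (t : ℝ) (x : X) : ℝ := ∑' i, renormTerm c t x i

variable {c}

lemma renormTerm_nonneg (t : ℝ) (x : X) (i : ℕ) : 0 ≤ renormTerm c t x i := by
  unfold renormTerm; positivity

lemma renormTerm_le (t : ℝ) (x : X) (i : ℕ) :
    renormTerm c t x i ≤ 2 * (|t| + ‖x‖) ^ 2 * (1 / 2) ^ i := by
  have key : ∀ y : X, ‖y‖ = ‖x‖ → ‖t • c i + y‖ ^ 2 ≤ (1 + ‖c i‖) ^ 2 * (|t| + ‖x‖) ^ 2 := by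
    intro y hy
    rw [← mul_pow]
    have h := norm_add_le (t • c i) y
    rw [norm_smul, Real.norm_eq_abs, hy] at h
    gcongr
    refine h.trans ?_
    nlinarith [mul_nonneg (norm_nonneg (c i)) (norm_nonneg x), abs_nonneg t]
  have h1 := key x rfl
  have h2 := key (-x) (norm_neg x)
  rw [← sub_eq_add_neg] at h2
  unfold renormTerm
  rw [div_mul_eq_mul_div, div_le_iff₀ (by positivity)]
  have : (0 : ℝ) ≤ (1 / 2) ^ i := by positivity
  nlinarith

lemma summable_renormTerm (t : ℝ) (x : X) : Summable (renormTerm c t x) :=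
  .of_nonneg_of_le (renormTerm_nonneg t x) (renormTerm_le t x)
    (summable_geometric_two.mul_left _)

lemma renormSq_le (t : ℝ) (x : X) : renormSq c t x ≤ 4 * (|t| + ‖x‖) ^ 2 := by
  refine ((summable_renormTerm t x).tsum_le_tsum (renormTerm_le t x)
    (summable_geometric_two.mul_left _)).trans ?_
  rw [tsum_mul_left, tsum_geometric_two]
  linarith

lemma le_renormSq (hc : c 0 = 0) (t : ℝ) (x : X) : 2 * ‖x‖ ^ 2 ≤ renormSq c t x := by
  refine le_trans ?_ ((summable_renormTerm t x).le_tsum 0 fun i _ => renormTerm_nonneg t x i)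
  simp [renormTerm, hc, two_mul]

lemma renormTerm_mono {s t : ℝ} (hs : 0 ≤ s) (hst : s ≤ t) (x : X) (i : ℕ) :
    renormTerm c s x i ≤ renormTerm c t x i := by
  rcases (hs.trans hst).eq_or_lt with h0 | ht
  · obtain rfl : s = t := by linarith
    exact le_rfl
  unfold renormTerm
  gcongr ?_ * ?_
  set a := (t + s) / (2 * t) with ha
  have ha0 : 0 ≤ a := by positivity
  have ha1 : a ≤ 1 := by rw [ha, div_le_one (by positivity)]; linarith
  have hst' : s = (2 * a - 1) * t := by rw [ha]; field_simp; ring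
  have h1 : ‖s • c i + x‖ ≤ a * ‖t • c i + x‖ + (1 - a) * ‖t • c i - x‖ := by
    have e : s • c i + x = a • (t • c i + x) + -((1 - a) • (t • c i - x)) := by
      rw [hst']; module
    rw [e]
    refine (norm_add_le _ _).trans_eq ?_
    rw [norm_neg, norm_smul, norm_smul, Real.norm_of_nonneg ha0,
      Real.norm_of_nonneg (by linarith)]
  have h2 : ‖s • c i - x‖ ≤ a * ‖t • c i - x‖ + (1 - a) * ‖t • c i + x‖ := by
    have e : s • c i - x = a • (t • c i - x) + -((1 - a) • (t • c i + x)) := by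
      rw [hst']; module
    rw [e]
    refine (norm_add_le _ _).trans_eq ?_
    rw [norm_neg, norm_smul, norm_smul, Real.norm_of_nonneg ha0,
      Real.norm_of_nonneg (by linarith)]
  have h1' := pow_le_pow_left₀ (norm_nonneg _) h1 2
  have h2' := pow_le_pow_left₀ (norm_nonneg _) h2 2
  nlinarith [mul_nonneg (mul_nonneg ha0 (sub_nonneg.2 ha1))
    (sq_nonneg (‖t • c i + x‖ - ‖t • c i - x‖))]

lemma renormSq_mono {s t : ℝ} (hs : 0 ≤ s) (hst : s ≤ t) (x : X) :
    renormSq c s x ≤ renormSq c t x :=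
  (summable_renormTerm s x).tsum_le_tsum (renormTerm_mono hs hst x) (summable_renormTerm t x)

lemma renormSq_smul (a t : ℝ) (x : X) : renormSq c (|a| * t) (a • x) = a ^ 2 * renormSq c t x := by
  unfold renormSq
  rw [← tsum_mul_left]
  congr 1
  ext i
  unfold renormTerm
  rcases le_total 0 a with ha | ha
  · rw [abs_of_nonneg ha, mul_smul, ← smul_add, ← smul_sub, norm_smul, norm_smul, mul_pow, mul_pow,
      Real.norm_eq_abs, sq_abs]
    ring
  · have e1 : (|a| * t) • c i + a • x = (-a) • (t • c i - x) := by
      rw [abs_of_nonpos ha]; module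
    have e2 : (|a| * t) • c i - a • x = (-a) • (t • c i + x) := by
      rw [abs_of_nonpos ha]; module
    rw [e1, e2, norm_smul, norm_smul, mul_pow, mul_pow, Real.norm_eq_abs, sq_abs]
    ring

lemma mul_sq_norm_add_le {A B : ℝ} (hA : 0 ≤ A) (hB : 0 ≤ B) (p q : X) :
    A * B * ‖p + q‖ ^ 2 ≤ (A + B) * (B * ‖p‖ ^ 2 + A * ‖q‖ ^ 2) := by
  have h := pow_le_pow_left₀ (norm_nonneg _) (norm_add_le p q) 2
  have := mul_le_mul_of_nonneg_left h (mul_nonneg hA hB)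
  nlinarith [sq_nonneg (B * ‖p‖ - A * ‖q‖)]

lemma mul_renormTerm_add_le {A B : ℝ} (hA : 0 ≤ A) (hB : 0 ≤ B) (s t : ℝ) (x y : X) (i : ℕ) :
    A * B * renormTerm c (s + t) (x + y) i ≤
      (A + B) * (B * renormTerm c s x i + A * renormTerm c t y i) := by
  have h1 := mul_sq_norm_add_le hA hB (s • c i + x) (t • c i + y)
  have h2 := mul_sq_norm_add_le hA hB (s • c i - x) (t • c i - y)
  rw [show s • c i + x + (t • c i + y) = (s + t) • c i + (x + y) by module] at h1
  rw [show s • c i - x + (t • c i - y) = (s + t) • c i - (x + y) by module] at h2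
  unfold renormTerm
  have hw : 0 ≤ (1 / 2 : ℝ) ^ i / (1 + ‖c i‖) ^ 2 := by positivity
  have := mul_le_mul_of_nonneg_left (add_le_add h1 h2) hw
  calc _ = _ := ?_
    _ ≤ _ := this
    _ = _ := ?_ <;> ring

lemma sqrt_renormSq_add_le (hc : c 0 = 0) (x y : X) :
    √(renormSq c ‖x + y‖ (x + y)) ≤ √(renormSq c ‖x‖ x) + √(renormSq c ‖y‖ y) := by
  rcases eq_or_ne x 0 with rfl | hx
  · simp
  rcases eq_or_ne y 0 with rfl | hy
  · simp
  have hpos : ∀ z : X, z ≠ 0 → 0 < renormSq c ‖z‖ z := fun z hz =>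
    lt_of_lt_of_le (by positivity [norm_pos_iff.2 hz]) (le_renormSq hc ‖z‖ z)
  have hA := Real.sqrt_pos.2 (hpos x hx)
  have hB := Real.sqrt_pos.2 (hpos y hy)
  have hA2 := Real.sq_sqrt (hpos x hx).le
  have hB2 := Real.sq_sqrt (hpos y hy).le
  set A := √(renormSq c ‖x‖ x)
  set B := √(renormSq c ‖y‖ y)
  refine Real.sqrt_le_iff.2 ⟨by positivity, ?_⟩
  refine (renormSq_mono (norm_nonneg _) (norm_add_le x y) _).trans ?_
  have h : A * B * renormSq c (‖x‖ + ‖y‖) (x + y) ≤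
      (A + B) * (B * renormSq c ‖x‖ x + A * renormSq c ‖y‖ y) := by
    have s1 := summable_renormTerm (c := c) ‖x‖ x
    have s2 := summable_renormTerm (c := c) ‖y‖ y
    unfold renormSq
    rw [← tsum_mul_left, ← tsum_mul_left, ← tsum_mul_left,
      ← (s1.mul_left B).tsum_add (s2.mul_left A), ← tsum_mul_left]
    exact ((summable_renormTerm _ _).mul_left _).tsum_le_tsum
      (mul_renormTerm_add_le hA.le hB.le _ _ _ _) (((s1.mul_left B).add (s2.mul_left A)).mul_left _)
  rw [← hA2, ← hB2] at h
  refine le_of_mul_le_mul_left (h.trans_eq ?_) (mul_pos hA hB)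
  ring

/-- The renorming attached to a sequence of centres `c` with `c 0 = 0`. -/
noncomputable def renorm (c : ℕ → X) (hc : c 0 = 0) : EquivNorm X where
  toFun x := √(renormSq c ‖x‖ x)
  add_le' := sqrt_renormSq_add_le hc
  smul' a x := by
    rw [norm_smul, Real.norm_eq_abs, renormSq_smul, Real.sqrt_mul (sq_nonneg a), Real.sqrt_sq_eq_abs]
  lower' := ⟨1, one_pos, fun x => by
    rw [one_mul]
    exact Real.le_sqrt_of_sq_le (by nlinarith [le_renormSq hc ‖x‖ x, sq_nonneg ‖x‖])⟩
  upper' := ⟨4, by norm_num, fun x => by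
    refine Real.sqrt_le_iff.2 ⟨by positivity, (renormSq_le _ _).trans ?_⟩
    rw [abs_norm]
    nlinarith [sq_nonneg ‖x‖]⟩

lemma parallelogram_defect_le (hc : c 0 = 0) (u v : X) (i : ℕ) :
    ((1 / 2) ^ i / (1 + ‖c i‖) ^ 2) * (2 * ‖‖u‖ • c i + u‖ ^ 2 + 2 * ‖‖v‖ • c i + v‖ ^ 2 -
      ‖(‖u‖ + ‖v‖) • c i + (u + v)‖ ^ 2) ≤
    2 * (renorm c hc).toFun u ^ 2 + 2 * (renorm c hc).toFun v ^ 2 -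
      (renorm c hc).toFun (u + v) ^ 2 := by
  have hnn : ∀ t x, 0 ≤ renormSq c t x := fun t x =>
    tsum_nonneg (renormTerm_nonneg t x)
  change _ ≤ 2 * √(renormSq c ‖u‖ u) ^ 2 + 2 * √(renormSq c ‖v‖ v) ^ 2 -
    √(renormSq c ‖u + v‖ (u + v)) ^ 2
  rw [Real.sq_sqrt (hnn _ _), Real.sq_sqrt (hnn _ _), Real.sq_sqrt (hnn _ _)]
  refine le_trans ?_ (sub_le_sub_left
    (renormSq_mono (c := c) (norm_nonneg _) (norm_add_le u v) (u + v)) _)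
  have s1 := (summable_renormTerm (c := c) ‖u‖ u).mul_left 2
  have s2 := (summable_renormTerm (c := c) ‖v‖ v).mul_left 2
  have s3 := summable_renormTerm (c := c) (‖u‖ + ‖v‖) (u + v)
  have hpar : ∀ p q : X, 0 ≤ 2 * ‖p‖ ^ 2 + 2 * ‖q‖ ^ 2 - ‖p + q‖ ^ 2 := fun p q => by
    have := mul_sq_norm_add_le zero_le_one zero_le_one p q
    linarith
  have hterm : ∀ j, 2 * renormTerm c ‖u‖ u j + 2 * renormTerm c ‖v‖ v j -
      renormTerm c (‖u‖ + ‖v‖) (u + v) j = ((1 / 2) ^ j / (1 + ‖c j‖) ^ 2) *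
        ((2 * ‖‖u‖ • c j + u‖ ^ 2 + 2 * ‖‖v‖ • c j + v‖ ^ 2 -
          ‖(‖u‖ + ‖v‖) • c j + (u + v)‖ ^ 2) +
        (2 * ‖‖u‖ • c j - u‖ ^ 2 + 2 * ‖‖v‖ • c j - v‖ ^ 2 -
          ‖(‖u‖ + ‖v‖) • c j - (u + v)‖ ^ 2)) := fun j => by
    unfold renormTerm; ring
  have hp1 : ∀ j, 0 ≤ 2 * ‖‖u‖ • c j + u‖ ^ 2 + 2 * ‖‖v‖ • c j + v‖ ^ 2 -
      ‖(‖u‖ + ‖v‖) • c j + (u + v)‖ ^ 2 := fun j => by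
    have := hpar (‖u‖ • c j + u) (‖v‖ • c j + v)
    rwa [show ‖u‖ • c j + u + (‖v‖ • c j + v) = (‖u‖ + ‖v‖) • c j + (u + v) by module] at this
  have hp2 : ∀ j, 0 ≤ 2 * ‖‖u‖ • c j - u‖ ^ 2 + 2 * ‖‖v‖ • c j - v‖ ^ 2 -
      ‖(‖u‖ + ‖v‖) • c j - (u + v)‖ ^ 2 := fun j => by
    have := hpar (‖u‖ • c j - u) (‖v‖ • c j - v)
    rwa [show ‖u‖ • c j - u + (‖v‖ • c j - v) = (‖u‖ + ‖v‖) • c j - (u + v) by module] at this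
  unfold renormSq
  rw [← tsum_mul_left, ← tsum_mul_left, ← s1.tsum_add s2, ← (s1.add s2).tsum_sub s3]
  refine le_trans ?_ (((s1.add s2).sub s3).le_tsum i fun j _ => ?_)
  · rw [hterm]
    gcongr
    linarith [hp2 i]
  · rw [hterm]
    exact mul_nonneg (by positivity) (add_nonneg (hp1 j) (hp2 j))

end Renorming

lemma tendsto_norm_add_typeLim {x : ℕ → X} {M : ℝ} (hx : ∀ k, ‖x k‖ ≤ M) {w : ℕ → X} {z : X}
    (hw : Tendsto w (hyperfilter ℕ) (𝓝 z)) :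
    Tendsto (fun k => ‖w k + x k‖) (hyperfilter ℕ) (𝓝 (typeLim x z)) := by
  have h0 : Tendsto (fun k => ‖w k - z‖) (hyperfilter ℕ : Filter ℕ) (𝓝 0) := by
    simpa using (hw.sub_const z).norm
  have h1 := (tendsto_typeLim hx z).sub h0
  have h2 := (tendsto_typeLim hx z).add h0
  rw [sub_zero] at h1
  rw [add_zero] at h2
  refine tendsto_of_tendsto_of_tendsto_of_le_of_le h1 h2 (fun k => ?_) fun k => ?_
  · have := norm_sub_le (w k + x k) (w k - z)
    rw [show w k + x k - (w k - z) = z + x k by abel] at this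
    simp only
    linarith
  · have := norm_add_le (z + x k) (w k - z)
    rwa [show z + x k + (w k - z) = w k + x k by abel] at this

lemma tendsto_typeLim_add {x y : ℕ → X} {M M' : ℝ} (hx : ∀ k, ‖x k‖ ≤ M) (hy : ∀ k, ‖y k‖ ≤ M')
    {w : ℕ → X} {z : X} (hw : Tendsto w (hyperfilter ℕ) (𝓝 z)) :
    Tendsto (fun m => typeLim y (w m + x m)) (hyperfilter ℕ)
      (𝓝 (ultraLim fun m => typeLim y (z + x m))) := by
  have h0 : Tendsto (fun k => ‖w k - z‖) (hyperfilter ℕ : Filter ℕ) (𝓝 0) := by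
    simpa using (hw.sub_const z).norm
  have h1 := (tendsto_typeLim_typeLim hx hy z).sub h0
  have h2 := (tendsto_typeLim_typeLim hx hy z).add h0
  rw [sub_zero] at h1
  rw [add_zero] at h2
  refine tendsto_of_tendsto_of_tendsto_of_le_of_le h1 h2 (fun k => ?_) fun k => ?_
  · have := typeLim_le_add' hy (z + x k) (w k + x k)
    rw [show z + x k - (w k + x k) = -(w k - z) by abel, norm_neg] at this
    simp only
    linarith
  · have := typeLim_le_add' hy (w k + x k) (z + x k)
    rwa [show w k + x k - (z + x k) = w k - z by abel] at this

lemma continuous_typeLim {x : ℕ → X} {M : ℝ} (hx : ∀ k, ‖x k‖ ≤ M) : Continuous (typeLim x) :=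
  (LipschitzWith.of_le_add fun z w => by
    rw [dist_eq_norm]; exact typeLim_le_add' hx z w).continuous

lemma continuous_ultraLim_typeLim {x y : ℕ → X} {M M' : ℝ} (hx : ∀ k, ‖x k‖ ≤ M)
    (hy : ∀ k, ‖y k‖ ≤ M') : Continuous fun z => ultraLim fun m => typeLim y (z + x m) :=
  (LipschitzWith.of_le_add fun z w => by
    rw [dist_eq_norm]
    refine le_of_tendsto_of_tendsto' (tendsto_typeLim_typeLim hx hy z)
      ((tendsto_typeLim_typeLim hx hy w).add_const _) fun m => ?_
    have := typeLim_le_add' hy (z + x m) (w + x m)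
    rwa [add_sub_add_right_eq_sub] at this).continuous

/-- If the iterated limit of `renorm c (x m + y n)` is at least `2` for normalized `x` and `y`, the
types of `x` and `y` satisfy the equality case of the parallelogram inequality at the centres. -/
lemma typeLim_eq_and_le_of_renorm {c : ℕ → X} (hc : c 0 = 0) {x y : ℕ → X} {M : ℝ}
    (hx : ∀ k, ‖x k‖ ≤ M) (hy : ∀ k, ‖y k‖ ≤ M)
    (hxn : NormalizedW (renorm c hc).toFun x) (hyn : NormalizedW (renorm c hc).toFun y)
    {L : ℝ} (hL : 2 ≤ L) {g : ℕ → ℝ}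
    (hg : ∀ m, Tendsto (fun n => (renorm c hc).toFun (x m + y n)) atTop (𝓝 (g m)))
    (hgL : Tendsto g atTop (𝓝 L)) (i : ℕ) :
    typeLim x (typeLim x 0 • c i) = typeLim y (typeLim y 0 • c i) ∧
      2 * typeLim x (typeLim x 0 • c i) ≤
        ultraLim fun m => typeLim y ((typeLim x 0 + typeLim y 0) • c i + x m) := by
  set a := typeLim x 0
  set b := typeLim y 0
  have ha : Tendsto (fun k => ‖x k‖) (hyperfilter ℕ) (𝓝 a) := by simpa using tendsto_typeLim hx 0
  have hb : Tendsto (fun k => ‖y k‖) (hyperfilter ℕ) (𝓝 b) := by simpa using tendsto_typeLim hy 0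
  have h1 : ∀ m, ((1 / 2) ^ i / (1 + ‖c i‖) ^ 2) * (2 * ‖‖x m‖ • c i + x m‖ ^ 2 +
      2 * typeLim y (b • c i) ^ 2 - typeLim y ((‖x m‖ + b) • c i + x m) ^ 2) ≤
      2 * 1 ^ 2 + 2 * 1 ^ 2 - g m ^ 2 := fun m => by
    have t1 := tendsto_norm_add_typeLim hy (hb.smul_const (c i))
    have t2 := tendsto_norm_add_typeLim hy
      (((hb.const_add ‖x m‖).smul_const (c i)).add_const (x m))
    refine le_of_tendsto_of_tendsto' ((((t1.pow 2).const_mul 2).const_add _ |>.sub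
      (t2.pow 2)).const_mul _) ((((hg m).hyperfilter).pow 2).const_sub _) fun n => ?_
    have := parallelogram_defect_le hc (x m) (y n) i
    rw [hxn m, hyn n, ← add_assoc] at this
    exact this
  have h2 : ((1 / 2) ^ i / (1 + ‖c i‖) ^ 2) * (2 * typeLim x (a • c i) ^ 2 +
      2 * typeLim y (b • c i) ^ 2 -
        (ultraLim fun m => typeLim y ((a + b) • c i + x m)) ^ 2) ≤
      2 * 1 ^ 2 + 2 * 1 ^ 2 - L ^ 2 := by
    have t1 := tendsto_norm_add_typeLim hx (ha.smul_const (c i))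
    have t2 := tendsto_typeLim_add hx hy ((ha.add_const b).smul_const (c i))
    exact le_of_tendsto_of_tendsto' (((((t1.pow 2).const_mul 2).add_const _).sub
      (t2.pow 2)).const_mul _) ((hgL.hyperfilter.pow 2).const_sub _) h1
  set σ := typeLim x (a • c i)
  set τ := typeLim y (b • c i)
  set κ := ultraLim fun m => typeLim y ((a + b) • c i + x m)
  have h3 : κ ≤ σ + τ := by
    refine le_of_tendsto_of_tendsto' (tendsto_typeLim_typeLim hx hy _)
      ((tendsto_typeLim hx (a • c i)).add_const τ) fun m => ?_
    refine le_of_tendsto_of_tendsto' (tendsto_typeLim hy _)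
      ((tendsto_typeLim hy (b • c i)).const_add _) fun n => ?_
    rw [show (a + b) • c i + x m + y n = (a • c i + x m) + (b • c i + y n) by module]
    exact norm_add_le _ _
  have h4 : 0 ≤ κ := ge_of_tendsto' (tendsto_typeLim_typeLim hx hy _) fun m =>
    ge_of_tendsto' (tendsto_typeLim hy _) fun n => norm_nonneg _
  have hw : 0 < (1 / 2 : ℝ) ^ i / (1 + ‖c i‖) ^ 2 := by positivity
  have h5 : 2 * σ ^ 2 + 2 * τ ^ 2 - κ ^ 2 ≤ 0 := by
    by_contra! h
    have := mul_pos hw h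
    nlinarith
  have h6 : κ ^ 2 ≤ (σ + τ) ^ 2 := pow_le_pow_left₀ h4 h3 2
  have h7 : σ = τ := by
    have : (σ - τ) ^ 2 ≤ 0 := by nlinarith
    nlinarith [pow_eq_zero_iff two_ne_zero |>.1 (le_antisymm this (sq_nonneg _))]
  refine ⟨h7, ?_⟩
  rw [← h7] at h5
  exact le_of_sq_le_sq (by nlinarith) h4

theorem IsReflexive.exists_equivNorm [TopologicalSpace.SeparableSpace X] (hX : IsReflexive X) :
    ∃ N : EquivNorm X, ∀ (E : Type) [NormedAddCommGroup E] [NormedSpace ℝ E] (e : ℕ → E),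
      IsAsymptoticModelW N.toFun e → ‖e 0 + e 1‖ < 2 := by
  let c : ℕ → X := fun n => Nat.casesOn n 0 (TopologicalSpace.denseSeq X)
  have hc : c 0 = 0 := rfl
  have hd : DenseRange c := (TopologicalSpace.denseRange_denseSeq X).mono <| by
    rintro _ ⟨n, rfl⟩
    exact ⟨n + 1, rfl⟩
  refine ⟨renorm c hc, fun E _ _ e he => ?_⟩
  obtain ⟨-, -, y, ⟨K, hK, -⟩, hgen⟩ := he
  by_contra! hL
  obtain ⟨g, hg, hgL⟩ := hgen 2 fun _ => 1
  have hg' : ∀ m, Tendsto (fun n => (renorm c hc).toFun (y 0 m + y 1 n)) atTop (𝓝 (g m)) := by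
    intro m
    obtain ⟨g', hg', hlim⟩ := hg m
    refine hlim.congr fun n => ?_
    rw [← hg' n]
    simp
  have hgL' : Tendsto g atTop (𝓝 ‖e 0 + e 1‖) := by
    simpa [Finset.sum_range_succ] using hgL
  obtain ⟨A, hA, hlow⟩ := (renorm c hc).lower'
  obtain ⟨B, hB, hup⟩ := (renorm c hc).upper'
  have hbd : ∀ n k, ‖y n k‖ ≤ A⁻¹ := fun n k => by
    have := hlow (y n k)
    rw [(hK n).1 k] at this
    rwa [inv_eq_one_div, le_div_iff₀' hA]
  have hbd' : ∀ n k, B⁻¹ ≤ ‖y n k‖ := fun n k => by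
    have := hup (y n k)
    rw [(hK n).1 k] at this
    rwa [inv_le_iff_one_le_mul₀' hB]
  have hpos : 0 < typeLim (y 0) 0 :=
    (inv_pos.2 hB).trans_le <| ge_of_tendsto' (tendsto_typeLim (hbd 0) 0) fun k => by
      simpa using hbd' 0 k
  have key := typeLim_eq_and_le_of_renorm hc (hbd 0) (hbd 1) (hK 0).1 (hK 1).1 hL hg' hgL'
  have hab : typeLim (y 0) 0 = typeLim (y 1) 0 := by simpa [hc] using (key 0).1
  rw [← hab] at key
  set a := typeLim (y 0) 0
  have hall : ∀ z, typeLim (y 0) (a • z) = typeLim (y 1) (a • z) ∧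
      2 * typeLim (y 0) (a • z) ≤ ultraLim fun m => typeLim (y 1) ((a + a) • z + y 0 m) := by
    intro z
    refine hd.induction_on (p := fun z => typeLim (y 0) (a • z) = typeLim (y 1) (a • z) ∧
      2 * typeLim (y 0) (a • z) ≤ ultraLim fun m => typeLim (y 1) ((a + a) • z + y 0 m)) z ?_ key
    have c0 := (continuous_typeLim (hbd 0)).comp (continuous_const_smul a)
    have c1 := (continuous_typeLim (hbd 1)).comp (continuous_const_smul a)
    have c2 := (continuous_ultraLim_typeLim (hbd 0) (hbd 1)).comp (continuous_const_smul (a + a))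
    exact (isClosed_eq c0 c1).inter (isClosed_le (c0.const_mul 2) c2)
  have hall' : ∀ z, typeLim (y 0) z = typeLim (y 1) z ∧
      2 * typeLim (y 0) z ≤ ultraLim fun m => typeLim (y 1) ((2 : ℝ) • z + y 0 m) := by
    intro z
    have h := hall (a⁻¹ • z)
    rwa [smul_smul, smul_smul, add_mul, mul_inv_cancel₀ hpos.ne', one_smul, one_add_one_eq_two] at h
  obtain ⟨f, u, hu, hf⟩ := exists_functional_frequently_le (hbd 0) (fun z => by
    simp only [(hall' _).1]
    have := (hall' z).2
    rwa [(hall' z).1] at this) hpos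
  exact hX.not_frequently_le (renorm c hc) (hK 0).1 (hK 0).2 f hu hf

section NonReflexive

set_option maxSynthPendingDepth 3

open NormedSpace

local notation "J" => inclusionInDoubleDual ℝ X

/-- Goldstine's theorem for finitely many functionals. -/
lemma exists_norm_le_one_forall_abs_sub_lt (φ : StrongDual ℝ (StrongDual ℝ X)) (hφ : ‖φ‖ ≤ 1)
    {n : ℕ} (f : Fin n → StrongDual ℝ X) {ε : ℝ} (hε : 0 < ε) :
    ∃ x : X, ‖x‖ ≤ 1 ∧ ∀ j, |f j x - φ (f j)| < ε := by
  let T : X →L[ℝ] (Fin n → ℝ) := ContinuousLinearMap.pi f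
  let p : Fin n → ℝ := fun j => φ (f j)
  have hp : p ∈ closure (T '' Metric.closedBall 0 1) := by
    by_contra hp
    have hconv : Convex ℝ (closure (T '' Metric.closedBall 0 1)) :=
      ((convex_closedBall (0 : X) 1).linear_image T.toLinearMap).closure
    obtain ⟨g, u, hg, hu⟩ := geometric_hahn_banach_closed_point hconv isClosed_closure hp
    let F : StrongDual ℝ X := g ∘L T
    have hF : ∀ v : Fin n → ℝ, g v = ∑ j, v j * g (Pi.single j 1) := fun v => by
      conv_lhs => rw [← Finset.univ_sum_single v]
      rw [map_sum]
      refine Finset.sum_congr rfl fun j _ => ?_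
      rw [← smul_eq_mul, ← map_smul, ← Pi.single_smul, smul_eq_mul, mul_one]
    have hF' : F = ∑ j, g (Pi.single j 1) • f j := by
      ext x
      rw [_root_.sum_apply]
      refine (hF (T x)).trans ?_
      refine Finset.sum_congr rfl fun j _ => ?_
      simp [T, mul_comm]
    have hφF : φ F = g p := by
      rw [hF', map_sum, hF]
      refine Finset.sum_congr rfl fun j _ => ?_
      simp [p, mul_comm]
    have hball : ∀ x : X, ‖x‖ ≤ 1 → F x ≤ u := fun x hx =>
      (hg _ (subset_closure ⟨x, by simpa using hx, rfl⟩)).le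
    have hu0 : 0 ≤ u := by simpa using hball 0 (by simp)
    have hFu : ‖F‖ ≤ u := by
      refine F.opNorm_le_of_unit_norm hu0 fun x hx => ?_
      rw [Real.norm_eq_abs]
      refine abs_le.2 ⟨?_, hball x hx.le⟩
      have := hball (-x) (by rw [norm_neg, hx])
      rw [map_neg] at this
      linarith
    have := (le_abs_self _).trans ((φ.le_opNorm F).trans
      (mul_le_mul hφ hFu (norm_nonneg _) zero_le_one))
    linarith
  obtain ⟨_, ⟨x, hx, rfl⟩, hd⟩ := Metric.mem_closure_iff.1 hp ε hε
  refine ⟨x, by simpa using hx, fun j => ?_⟩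
  have := (dist_pi_lt_iff hε).1 hd j
  rwa [dist_comm, Real.dist_eq] at this

lemma exists_norming_sequence [TopologicalSpace.SeparableSpace X]
    (φ : StrongDual ℝ (StrongDual ℝ X)) :
    ∃ f : ℕ → StrongDual ℝ X, (∀ n, ‖f n‖ ≤ 1) ∧ ∀ (z : X) (s θ : ℝ), θ < ‖J z + s • φ‖ →
      ∃ n, θ < (J z + s • φ) (f n) := by
  have hex : ∀ (ψ : StrongDual ℝ (StrongDual ℝ X)) (m : ℕ), ∃ f : StrongDual ℝ X, ‖f‖ ≤ 1 ∧
      ‖ψ‖ - 1 / (m + 1) < ψ f := by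
    intro ψ m
    by_contra! h
    have h0 : 0 ≤ ‖ψ‖ - 1 / (m + 1) := by simpa using h 0 (by simp)
    have : ‖ψ‖ ≤ ‖ψ‖ - 1 / (m + 1) := by
      refine ψ.opNorm_le_of_unit_norm h0 fun f hf => ?_
      rw [Real.norm_eq_abs]
      refine abs_le.2 ⟨?_, h f hf.le⟩
      have := h (-f) (by rw [norm_neg, hf])
      rw [map_neg] at this
      linarith
    have : (0 : ℝ) < 1 / (m + 1) := by positivity
    linarith
  choose F hF1 hF2 using hex
  let d := TopologicalSpace.denseSeq (X × ℝ)
  let Ψ : X × ℝ → StrongDual ℝ (StrongDual ℝ X) := fun p => J p.1 + p.2 • φ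
  have hΨ : Continuous Ψ := by fun_prop
  refine ⟨fun n => F (Ψ (d n.unpair.1)) n.unpair.2, fun n => hF1 _ _, fun z s θ hθ => ?_⟩
  obtain ⟨m, hm⟩ := exists_nat_one_div_lt (show 0 < (‖J z + s • φ‖ - θ) / 3 by linarith)
  obtain ⟨k, hk⟩ := (TopologicalSpace.denseRange_denseSeq (X × ℝ)).exists_mem_open
    (s := {p | ‖Ψ p - Ψ (z, s)‖ < (‖J z + s • φ‖ - θ) / 3})
    (isOpen_lt (hΨ.sub continuous_const).norm continuous_const) ⟨(z, s), by
      simp only [Set.mem_ofPred_eq, sub_self, norm_zero]; linarith⟩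
  refine ⟨Nat.pair k m, ?_⟩
  simp only [Nat.unpair_pair]
  change ‖Ψ (d k) - Ψ (z, s)‖ < (‖Ψ (z, s)‖ - θ) / 3 at hk
  change _ < (‖Ψ (z, s)‖ - θ) / 3 at hm
  change θ < Ψ (z, s) _
  have h1 := hF2 (Ψ (d k)) m
  have h2 : ‖Ψ (z, s)‖ ≤ ‖Ψ (d k)‖ + ‖Ψ (d k) - Ψ (z, s)‖ := by
    have := norm_sub_le (Ψ (d k)) (Ψ (d k) - Ψ (z, s))
    rwa [sub_sub_cancel] at this
  have h3 := (le_abs_self _).trans (((Ψ (d k) - Ψ (z, s)).le_opNorm (F (Ψ (d k)) m)).trans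
    (mul_le_of_le_one_right (norm_nonneg _) (hF1 _ _)))
  rw [_root_.sub_apply] at h3
  linarith

lemma exists_normalized_tendsto [TopologicalSpace.SeparableSpace X]
    (φ : StrongDual ℝ (StrongDual ℝ X)) (hφ : ‖φ‖ = 1) :
    ∃ x : ℕ → X, (∀ i, ‖x i‖ = 1) ∧ ∀ (z : X) (s b θ : ℝ), θ < ‖J z + s • φ‖ →
      ∀ᶠ i in atTop, θ < ‖J z + s • φ + b • (J (x i) - φ)‖ := by
  obtain ⟨f, hf1, hf⟩ := exists_norming_sequence φ
  have hex : ∀ i : ℕ, ∃ x : X, ‖x‖ ≤ 1 ∧ ∀ j : Fin (i + 1), |f j x - φ (f j)| < 1 / ((i : ℝ) + 1) :=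
    fun i => exists_norm_le_one_forall_abs_sub_lt φ hφ.le (fun j : Fin (i + 1) => f j)
      (by positivity)
  choose x hx1 hx using hex
  have hlim : ∀ n, Tendsto (fun i => f n (x i)) atTop (𝓝 (φ (f n))) := fun n => by
    rw [tendsto_iff_norm_sub_tendsto_zero]
    refine squeeze_zero' (Eventually.of_forall fun _ => norm_nonneg _) ?_
      tendsto_one_div_add_atTop_nhds_zero_nat
    filter_upwards [eventually_ge_atTop n] with i hi
    exact (hx i ⟨n, Nat.lt_succ_of_le hi⟩).le
  have hnorm : Tendsto (fun i => ‖x i‖) atTop (𝓝 1) := by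
    refine tendsto_order.2 ⟨fun θ hθ => ?_, fun θ hθ => .of_forall fun i => (hx1 i).trans_lt hθ⟩
    obtain ⟨n, hn⟩ := hf 0 1 θ (by simpa [hφ] using hθ)
    filter_upwards [(hlim n).eventually_const_lt (by simpa using hn)] with i hi
    exact hi.trans_le ((le_abs_self _).trans (((f n).le_opNorm (x i)).trans
      (mul_le_of_le_one_left (norm_nonneg _) (hf1 n))))
  obtain ⟨i₀, hi₀⟩ := eventually_atTop.1 (hnorm.eventually_const_lt one_half_lt_one)
  refine ⟨fun i => ‖x (i + i₀)‖⁻¹ • x (i + i₀), fun i => ?_, fun z s b θ hθ => ?_⟩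
  · have := hi₀ (i + i₀) (Nat.le_add_left _ _)
    rw [norm_smul, norm_inv, norm_norm, inv_mul_cancel₀]
    linarith
  obtain ⟨n, hn⟩ := hf z s θ hθ
  have hlim' : Tendsto (fun i => f n (‖x (i + i₀)‖⁻¹ • x (i + i₀))) atTop (𝓝 (φ (f n))) := by
    have := ((hnorm.inv₀ one_ne_zero).mul (hlim n)).comp (tendsto_add_atTop_nat i₀)
    simpa [Function.comp_def] using this
  have hlim2 := ((hlim'.sub_const (φ (f n))).const_mul b).const_add ((J z + s • φ) (f n))
  rw [sub_self, mul_zero, add_zero] at hlim2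
  filter_upwards [hlim2.eventually_const_lt hn] with i hi
  refine hi.trans_le ((le_abs_self _).trans (le_trans (le_of_eq ?_)
    ((ContinuousLinearMap.le_opNorm _ (f n)).trans
      (mul_le_of_le_one_right (norm_nonneg _) (hf1 n)))))
  rw [Real.norm_eq_abs]
  simp

lemma exists_norm_eq_one_of_not_isReflexive [CompleteSpace X] (hX : ¬ IsReflexive X) :
    ∃ φ : StrongDual ℝ (StrongDual ℝ X), ‖φ‖ = 1 ∧ ∃ δ > 0, ∀ (z : X) (s : ℝ),
      δ * |s| ≤ ‖J z + s • φ‖ := by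
  obtain ⟨φ₀, hφ₀⟩ : ∃ φ₀, ∀ z, J z ≠ φ₀ := by simpa [IsReflexive, Function.Surjective] using hX
  have h0 : φ₀ ≠ 0 := fun h => hφ₀ 0 (by simp [h])
  have hcl : IsClosed (Set.range J) :=
    (inclusionInDoubleDualLi ℝ (E := X)).isometry.isClosedEmbedding.isClosed_range
  set φ := ‖φ₀‖⁻¹ • φ₀ with hφ
  have hφr : φ ∉ Set.range J := by
    rintro ⟨z, hz⟩
    refine hφ₀ (‖φ₀‖ • z) ?_
    rw [map_smul, hz, hφ, smul_smul, mul_inv_cancel₀ (norm_ne_zero_iff.2 h0), one_smul]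
  refine ⟨φ, norm_smul_inv_norm h0, Metric.infDist φ (Set.range J),
    (hcl.notMem_iff_infDist_pos (Set.range_nonempty _)).1 hφr, fun z s => ?_⟩
  rcases eq_or_ne s 0 with rfl | hs
  · simp
  have h1 : J z + s • φ = s • (φ - J (-(s⁻¹ • z))) := by
    rw [map_neg, map_smul, smul_sub, smul_neg, smul_inv_smul₀ hs]
    abel
  rw [h1, norm_smul, Real.norm_eq_abs, mul_comm, ← dist_eq_norm]
  exact mul_le_mul_of_nonneg_left (Metric.infDist_le_dist_of_mem ⟨_, rfl⟩) (abs_nonneg s)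

end NonReflexive

section BasicSelection

set_option maxSynthPendingDepth 3

lemma eventually_forall_norm_le_mul {w : ℕ → X} {M δ : ℝ} (hM : ∀ k, ‖w k‖ ≤ M) (hδ : 0 < δ)
    (hw : ∀ k, δ ≤ ‖w k‖) (G : Submodule ℝ X) [FiniteDimensional ℝ G]
    (h : ∀ g ∈ G, ∀ b θ : ℝ, θ < ‖g‖ → ∀ᶠ k in atTop, θ < ‖g + b • w k‖) {c : ℝ} (hc : 1 < c) :
    ∀ᶠ k in atTop, ∀ g ∈ G, ∀ a : ℝ, ‖g‖ ≤ c * ‖g + a • w k‖ := by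
  have hc0 : 0 < c := zero_lt_one.trans hc
  have hS : IsCompact (Metric.sphere (0 : G) 1 ×ˢ Set.Icc (-(2 / δ)) (2 / δ)) :=
    (isCompact_sphere 0 1).prod isCompact_Icc
  have key := hS.eventually_forall_lt (l := atTop) (θ := c⁻¹)
    (Φ := fun k p => ‖(p.1 : X) + p.2 • w k‖) (fun p _ => ?_) (fun p hp => ?_)
  · filter_upwards [key] with k hk g hg a
    rcases eq_or_ne g 0 with rfl | hg0
    · rw [norm_zero]; positivity
    have hgn : 0 < ‖g‖ := norm_pos_iff.2 hg0
    have hunit : ∀ b : ℝ, 1 ≤ c * ‖‖g‖⁻¹ • g + b • w k‖ := fun b => by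
      rcases le_or_gt |b| (2 / δ) with hb | hb
      · have := hk (⟨‖g‖⁻¹ • g, G.smul_mem _ hg⟩, b) ⟨by
          simp [norm_smul, hgn.ne'], abs_le.1 hb⟩
        exact ((inv_lt_iff_one_lt_mul₀' hc0).1 this).le
      · have h1 : ‖b • w k‖ - ‖‖g‖⁻¹ • g‖ ≤ ‖‖g‖⁻¹ • g + b • w k‖ := by
          rw [add_comm]
          have := norm_sub_norm_le (b • w k) (-(‖g‖⁻¹ • g))
          rwa [norm_neg, sub_neg_eq_add] at this
        have h2 : ‖‖g‖⁻¹ • g‖ = 1 := norm_smul_inv_norm hg0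
        have h3 : 2 ≤ ‖b • w k‖ := by
          rw [norm_smul, Real.norm_eq_abs]
          calc (2 : ℝ) = 2 / δ * δ := by field_simp
            _ ≤ |b| * ‖w k‖ := mul_le_mul hb.le (hw k) hδ.le (abs_nonneg b)
        nlinarith
    have h4 := mul_le_mul_of_nonneg_left (hunit (‖g‖⁻¹ * a)) hgn.le
    have h5 : ‖g‖ * ‖‖g‖⁻¹ • g + (‖g‖⁻¹ * a) • w k‖ = ‖g + a • w k‖ := by
      rw [mul_smul, ← smul_add, norm_smul, norm_inv, norm_norm, mul_inv_cancel_left₀ hgn.ne']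
    rw [mul_one, mul_left_comm, h5] at h4
    exact h4
  · refine ⟨fun q => ‖(p.1 : X) - q.1‖ + |p.2 - q.2| * M, ?_, fun k q _ => ?_⟩
    · have : Continuous fun q : G × ℝ => ‖(p.1 : X) - q.1‖ + |p.2 - q.2| * M := by fun_prop
      have h0 := this.tendsto p
      simp only [sub_self, norm_zero, abs_zero, zero_mul, add_zero] at h0
      exact h0.mono_left nhdsWithin_le_nhds
    · calc ‖(p.1 : X) + p.2 • w k‖
          = ‖((q.1 : X) + q.2 • w k) + (((p.1 : X) - q.1) + (p.2 - q.2) • w k)‖ := by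
            congr 1; module
        _ ≤ ‖(q.1 : X) + q.2 • w k‖ + (‖(p.1 : X) - q.1‖ + ‖(p.2 - q.2) • w k‖) :=
            (norm_add_le _ _).trans (by gcongr; exact norm_add_le _ _)
        _ ≤ _ := by simp only; gcongr; exact smul_bound hM _ k
  · have h1 : c⁻¹ < 1 := inv_lt_one_of_one_lt₀ hc
    obtain ⟨η, hη, hη1⟩ := exists_between h1
    refine ⟨η, hη, h p.1 p.1.2 p.2 η ?_⟩
    have : ‖p.1‖ = 1 := by simpa using hp.1
    rw [← Submodule.coe_norm, this]
    exact hη1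

/-- Mazur's selection of a basic subsequence, relative to an additional vector `φ`. -/
lemma exists_strictMono_norm_sum_le {w : ℕ → X} {M δ : ℝ} (hM : ∀ k, ‖w k‖ ≤ M) (hδ : 0 < δ)
    (hw : ∀ k, δ ≤ ‖w k‖) (V : Submodule ℝ X) {φ : X} (hφ : φ ∈ V) (hwV : ∀ k, w k ∈ V)
    (h : ∀ g ∈ V, ∀ b θ : ℝ, θ < ‖g‖ → ∀ᶠ k in atTop, θ < ‖g + b • w k‖) :
    ∃ k : ℕ → ℕ, StrictMono k ∧ ∀ (s : ℝ) (a : ℕ → ℝ) (n m : ℕ), n ≤ m →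
      ‖s • φ + ∑ i ∈ Finset.range n, a i • w (k i)‖ ≤
        2 * ‖s • φ + ∑ i ∈ Finset.range m, a i • w (k i)‖ := by
  let G : ℕ → Submodule ℝ X := fun p => Submodule.span ℝ (insert φ (w '' Set.Iio p))
  have hfin : ∀ p, FiniteDimensional ℝ (G p) := fun p =>
    FiniteDimensional.span_of_finite ℝ (((Set.finite_Iio p).image w).insert φ)
  have hGV : ∀ p, G p ≤ V := fun p => Submodule.span_le.2 <| by
    rintro _ (rfl | ⟨i, -, rfl⟩)
    exacts [hφ, hwV i]
  let c : ℕ → ℝ := fun n => 1 + (1 / 2) ^ n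
  have hc1 : ∀ n, 1 < c n := fun n => by simp [c]
  have hc0 : ∀ n, 0 < c n := fun n => one_pos.trans (hc1 n)
  have hc2 : ∀ n, c n ≤ 2 := fun n => by
    have : (1 / 2 : ℝ) ^ n ≤ 1 := pow_le_one₀ (by norm_num) (by norm_num)
    simp only [c]; linarith
  have hcr : ∀ n, 1 < c n / c (n + 1) := fun n => by
    rw [one_lt_div (hc0 _)]
    have : (0 : ℝ) < (1 / 2) ^ n := by positivity
    simp only [c, pow_succ]; linarith
  have hev : ∀ n p, ∃ t, ∀ k ≥ t, ∀ g ∈ G p, ∀ a : ℝ, ‖g‖ ≤ c n / c (n + 1) * ‖g + a • w k‖ :=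
    fun n p => eventually_atTop.1 (eventually_forall_norm_le_mul hM hδ hw (G p)
      (fun g hg => h g (hGV p hg)) (hcr n))
  choose t ht using hev
  let p : ℕ → ℕ := fun n => Nat.rec 0 (fun n p => max (t n p) p + 1) n
  let k : ℕ → ℕ := fun n => max (t n (p n)) (p n)
  have hp : ∀ n, p (n + 1) = k n + 1 := fun n => rfl
  have hpk : ∀ n, p n ≤ k n := fun n => le_max_right _ _
  have hk : StrictMono k := strictMono_nat_of_lt_succ fun n =>
    (Nat.lt_succ_self _).trans_le ((hp n).symm.le.trans (hpk (n + 1)))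
  have hkp : ∀ n, ∀ i < n, k i < p n := by
    intro n i hi
    obtain ⟨n, rfl⟩ : ∃ n', n = n' + 1 := ⟨n - 1, by omega⟩
    rw [hp]
    exact Nat.lt_succ_of_le (hk.monotone (Nat.le_of_lt_succ hi))
  refine ⟨k, hk, fun s a n m hnm => ?_⟩
  let e : ℕ → ℝ := fun n => ‖s • φ + ∑ i ∈ Finset.range n, a i • w (k i)‖ / c n
  have hmono : Monotone e := monotone_nat_of_le_succ fun n => by
    have hmem : s • φ + ∑ i ∈ Finset.range n, a i • w (k i) ∈ G (p n) :=
      (G (p n)).add_mem ((G (p n)).smul_mem _ (Submodule.subset_span (Set.mem_insert _ _)))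
        ((G (p n)).sum_mem fun i hi => (G (p n)).smul_mem _ (Submodule.subset_span
          (Set.mem_insert_of_mem _ ⟨k i, hkp n i (Finset.mem_range.1 hi), rfl⟩)))
    have := ht n (p n) (k n) (le_max_left _ _) _ hmem (a n)
    simp only [e]
    rw [Finset.sum_range_succ, ← add_assoc, div_le_iff₀ (hc0 n)]
    refine this.trans_eq ?_
    ring
  have := hmono hnm
  simp only [e] at this
  rw [div_le_div_iff₀ (hc0 n) (hc0 m)] at this
  have hn0 := norm_nonneg (s • φ + ∑ i ∈ Finset.range n, a i • w (k i))
  have hm0 := norm_nonneg (s • φ + ∑ i ∈ Finset.range m, a i • w (k i))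
  nlinarith [hc1 m, hc2 n]

lemma sum_range_extend {k : ℕ → ℕ} (hk : StrictMono k) (a : ℕ → ℝ) (x : ℕ → X) (n : ℕ) :
    ∑ j ∈ Finset.range (k n), Function.extend k a 0 j • x j =
      ∑ i ∈ Finset.range n, a i • x (k i) := by
  have h1 : ∑ i ∈ Finset.range n, a i • x (k i) =
      ∑ j ∈ (Finset.range n).image k, Function.extend k a 0 j • x j := by
    rw [Finset.sum_image hk.injective.injOn]
    exact Finset.sum_congr rfl fun i _ => by rw [hk.injective.extend_apply]
  rw [h1]
  refine (Finset.sum_subset ?_ fun j hj hj' => ?_).symm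
  · intro j hj
    obtain ⟨i, hi, rfl⟩ := Finset.mem_image.1 hj
    exact Finset.mem_range.2 (hk (Finset.mem_range.1 hi))
  · rw [Function.extend_apply', Pi.zero_apply, zero_smul]
    rintro ⟨i, rfl⟩
    exact hj' (Finset.mem_image_of_mem k (Finset.mem_range.2
      (hk.lt_iff_lt.1 (Finset.mem_range.1 hj))))

lemma IsCBasic.comp_strictMono {K : ℝ} {x : ℕ → X} (hx : IsCBasic K x) {k : ℕ → ℕ}
    (hk : StrictMono k) : IsCBasic K fun i => x (k i) :=
  ⟨fun i => hx.1 _, fun n m hnm a => by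
    rw [← sum_range_extend hk, ← sum_range_extend hk]
    exact hx.2 _ _ (hk hnm) _⟩

open NormedSpace in
/-- In a separable nonreflexive space there is a normalized basic sequence which behaves like a
sequence converging to an element `φ` of the bidual outside of the space. -/
lemma exists_isCBasic_of_not_isReflexive [CompleteSpace X] [TopologicalSpace.SeparableSpace X]
    (hX : ¬ IsReflexive X) :
    ∃ (φ : StrongDual ℝ (StrongDual ℝ X)) (δ : ℝ) (x : ℕ → X) (K : ℝ), ‖φ‖ = 1 ∧ 0 < δ ∧
      (∀ (z : X) (s : ℝ), δ * |s| ≤ ‖inclusionInDoubleDual ℝ X z + s • φ‖) ∧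
      (∀ i, ‖x i‖ = 1) ∧ IsCBasic K x ∧
      ∀ (z : X) (s b θ : ℝ), θ < ‖inclusionInDoubleDual ℝ X z + (b + s) • φ‖ →
        ∀ᶠ i in atTop, θ < ‖inclusionInDoubleDual ℝ X (z + b • x i) + s • φ‖ := by
  obtain ⟨φ, hφ, δ, hδ, hδφ⟩ := exists_norm_eq_one_of_not_isReflexive hX
  obtain ⟨x, hx1, hx⟩ := exists_normalized_tendsto φ hφ
  let J := inclusionInDoubleDual ℝ X
  have hJ : ∀ z, ‖J z‖ = ‖z‖ := (inclusionInDoubleDualLi ℝ).norm_map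
  let w := fun i => J (x i) - φ
  have hM : ∀ i, ‖w i‖ ≤ 2 := fun i => (norm_sub_le _ _).trans (by
    rw [hJ, hx1, hφ]; norm_num)
  have hwδ : ∀ i, δ ≤ ‖w i‖ := fun i => by
    have := hδφ (x i) (-1)
    rwa [abs_neg, abs_one, mul_one, neg_one_smul, ← sub_eq_add_neg] at this
  let V : Submodule ℝ (StrongDual ℝ (StrongDual ℝ X)) := LinearMap.range J.toLinearMap ⊔ ℝ ∙ φ
  have hφV : φ ∈ V := Submodule.mem_sup_right (Submodule.mem_span_singleton_self φ)
  have hJV : ∀ z, J z ∈ V := fun z => Submodule.mem_sup_left ⟨z, rfl⟩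
  obtain ⟨k, hk, hbas⟩ := exists_strictMono_norm_sum_le hM hδ hwδ V hφV
    (fun i => V.sub_mem (hJV _) hφV) (fun g hg b θ hθ => by
      obtain ⟨_, ⟨z, rfl⟩, _, hs, rfl⟩ := Submodule.mem_sup.1 hg
      obtain ⟨s, rfl⟩ := Submodule.mem_span_singleton.1 hs
      exact hx z s b θ hθ)
  refine ⟨φ, δ, x ∘ k, 2 * (1 + 1 / δ), hφ, hδ, hδφ, fun i => hx1 _, ⟨fun i h0 => ?_, ?_⟩, ?_⟩
  · have := hx1 (k i)
    rw [Function.comp_apply] at h0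
    rw [h0, norm_zero] at this
    exact zero_ne_one this
  · intro n m hnm a
    have hsum : ∀ r, ∑ i ∈ Finset.range r, a i • w (k i) =
        J (∑ i ∈ Finset.range r, a i • x (k i)) - (∑ i ∈ Finset.range r, a i) • φ := fun r => by
      rw [map_sum, Finset.sum_smul, ← Finset.sum_sub_distrib]
      exact Finset.sum_congr rfl fun i _ => by rw [map_smul, smul_sub]
    have h := hbas (∑ i ∈ Finset.range m, a i) a n m hnm.le
    rw [hsum, hsum, add_sub_cancel, hJ] at h
    set t := ∑ i ∈ Finset.range m, a i - ∑ i ∈ Finset.range n, a i with ht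
    set u := ∑ i ∈ Finset.range n, a i • x (k i)
    rw [show (∑ i ∈ Finset.range m, a i) • φ + (J u - (∑ i ∈ Finset.range n, a i) • φ) =
      J u + t • φ by rw [ht]; module] at h
    have h1 : |t| ≤ 1 / δ * ‖J u + t • φ‖ := by
      rw [one_div, ← div_eq_inv_mul, le_div_iff₀' hδ]
      exact hδφ u t
    have h2 : ‖u‖ ≤ ‖J u + t • φ‖ + |t| := by
      have := norm_sub_le (J u + t • φ) (t • φ)
      rwa [add_sub_cancel_right, hJ, norm_smul, hφ, mul_one, Real.norm_eq_abs] at this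
    calc ‖u‖ ≤ (1 + 1 / δ) * ‖J u + t • φ‖ := by linarith
      _ ≤ (1 + 1 / δ) * _ := mul_le_mul_of_nonneg_left h (by positivity)
      _ = _ := by simp only [Function.comp_apply]; ring
  · intro z s b θ hθ
    filter_upwards [hk.tendsto_atTop.eventually (hx z (b + s) b θ hθ)] with i hi
    refine hi.trans_eq (congrArg _ ?_)
    rw [map_add, map_smul, Function.comp_apply]
    module

end BasicSelection

section IteratedUltralimit

/-- The iterated ultralimit of `‖z + b 0 • x i₀ + ⋯ + b (n - 1) • x i_{n-1}‖`. -/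
noncomputable def iterLim (x : ℕ → X) : ℕ → (ℕ → ℝ) → X → ℝ
  | 0, _, z => ‖z‖
  | n + 1, b, z => ultraLim fun i => iterLim x n (fun j => b (j + 1)) (z + b 0 • x i)

variable {x : ℕ → X} (hx : ∀ i, ‖x i‖ = 1)

include hx in
lemma abs_iterLim_le (n : ℕ) (b : ℕ → ℝ) (z : X) :
    |iterLim x n b z| ≤ ‖z‖ + ∑ j ∈ Finset.range n, |b j| := by
  induction n generalizing b z with
  | zero => simp [iterLim]
  | succ n ih =>
    have h : ∀ i, |iterLim x n (fun j => b (j + 1)) (z + b 0 • x i)| ≤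
        ‖z‖ + ∑ j ∈ Finset.range (n + 1), |b j| := fun i => by
      refine (ih _ _).trans ?_
      rw [Finset.sum_range_succ', add_comm (∑ j ∈ Finset.range n, |b (j + 1)|), ← add_assoc]
      gcongr
      refine (norm_add_le _ _).trans_eq ?_
      rw [norm_smul, hx, mul_one, Real.norm_eq_abs]
    exact le_of_tendsto' (tendsto_ultraLim h).abs h

include hx in
lemma tendsto_iterLim (n : ℕ) (b : ℕ → ℝ) (z : X) :
    Tendsto (fun i => iterLim x n (fun j => b (j + 1)) (z + b 0 • x i)) (hyperfilter ℕ)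
      (𝓝 (iterLim x (n + 1) b z)) := by
  refine tendsto_ultraLim (C := ‖z‖ + |b 0| + ∑ j ∈ Finset.range n, |b (j + 1)|) fun i =>
    (abs_iterLim_le hx _ _ _).trans ?_
  gcongr
  refine (norm_add_le _ _).trans_eq ?_
  rw [norm_smul, hx, mul_one, Real.norm_eq_abs]

include hx in
lemma iterLim_add_le (n : ℕ) (b b' : ℕ → ℝ) (z z' : X) :
    iterLim x n (b + b') (z + z') ≤ iterLim x n b z + iterLim x n b' z' := by
  induction n generalizing b b' z z' with
  | zero => exact norm_add_le _ _
  | succ n ih =>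
    refine le_of_tendsto_of_tendsto' (tendsto_iterLim hx n _ _)
      ((tendsto_iterLim hx n b z).add (tendsto_iterLim hx n b' z')) fun i => ?_
    rw [show z + z' + (b + b') 0 • x i = (z + b 0 • x i) + (z' + b' 0 • x i) by
      rw [Pi.add_apply]; module]
    exact ih _ _ _ _

include hx in
lemma iterLim_smul (n : ℕ) (a : ℝ) (b : ℕ → ℝ) (z : X) :
    iterLim x n (a • b) (a • z) = |a| * iterLim x n b z := by
  induction n generalizing b z with
  | zero => exact norm_smul _ _
  | succ n ih =>
    refine ultraLim_eq (((tendsto_iterLim hx n b z).const_mul |a|).congr fun i => ?_)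
    rw [← ih, smul_add, smul_smul]
    rfl

lemma iterLim_congr (n : ℕ) {b b' : ℕ → ℝ} (h : ∀ j < n, b j = b' j) (z : X) :
    iterLim x n b z = iterLim x n b' z := by
  induction n generalizing b b' z with
  | zero => rfl
  | succ n ih =>
    simp only [iterLim]
    rw [h 0 n.succ_pos]
    congr 1
    ext i
    exact ih (fun j hj => h (j + 1) (by omega)) _

include hx in
lemma iterLim_succ_of_eq_zero (n : ℕ) {b : ℕ → ℝ} (h : b n = 0) (z : X) :
    iterLim x (n + 1) b z = iterLim x n b z := by
  induction n generalizing b z with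
  | zero => simp [iterLim, h]
  | succ n ih =>
    refine ultraLim_eq ((tendsto_iterLim hx n b z).congr fun i => ?_)
    exact (ih h _).symm

include hx in
lemma iterLim_eq_of_le {n m : ℕ} (hnm : n ≤ m) {b : ℕ → ℝ} (h : ∀ j, n ≤ j → b j = 0) (z : X) :
    iterLim x m b z = iterLim x n b z := by
  induction m, hnm using Nat.le_induction with
  | base => rfl
  | succ m hm ih => rw [iterLim_succ_of_eq_zero hx m (h m hm), ih]

include hx in
lemma iterLim_single (n : ℕ) : iterLim x (n + 1) (Pi.single n 1) 0 = 1 := by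
  induction n with
  | zero => simp [iterLim, hx]
  | succ n ih =>
    have h : ∀ i, iterLim x (n + 1) (fun j => (Pi.single (n + 1) 1 : ℕ → ℝ) (j + 1))
        (0 + (Pi.single (n + 1) 1 : ℕ → ℝ) 0 • x i) = 1 := fun i => by
      rw [Pi.single_eq_of_ne (by omega), zero_smul, add_zero]
      refine (iterLim_congr _ (fun j _ => ?_) _).trans ih
      simp [Pi.single_apply]
    rw [iterLim]
    simp_rw [h, ultraLim_const]

include hx in
lemma iterLim_le_add (n : ℕ) (b b' : ℕ → ℝ) (z z' : X) :
    iterLim x n b z ≤ iterLim x n b' z' + (‖z - z'‖ + ∑ j ∈ Finset.range n, |b j - b' j|) := by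
  have h := iterLim_add_le hx n b' (b - b') z' (z - z')
  rw [add_sub_cancel, add_sub_cancel] at h
  exact h.trans (add_le_add_right ((le_abs_self _).trans (abs_iterLim_le hx n _ _)) _)

section LowerBound

variable {q : X → ℝ → ℝ} {C : ℝ}
  (hq : ∀ z s b θ, θ < q z (b + s) → ∀ᶠ i in atTop, θ < q (z + b • x i) s)
  (hq0 : ∀ z, q z 0 = ‖z‖)

include hx hq hq0 in
lemma le_iterLim (n : ℕ) (b : ℕ → ℝ) (z : X) :
    q z (∑ j ∈ Finset.range n, b j) ≤ iterLim x n b z := by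
  induction n generalizing b z with
  | zero => simp [iterLim, hq0]
  | succ n ih =>
    refine le_of_forall_lt fun θ hθ => ?_
    obtain ⟨η, hη, hη'⟩ := exists_between hθ
    refine hη.trans_le (ge_of_tendsto (tendsto_iterLim hx n b z) ?_)
    rw [Finset.sum_range_succ', add_comm] at hη'
    filter_upwards [(hq _ _ _ _ hη').filter_mono Nat.hyperfilter_le_atTop] with i hi
    exact hi.le.trans (ih _ _)

include hx hq hq0 in
lemma iterLim_le_mul (hC : 0 ≤ C) (hqC : ∀ z s, ‖z‖ ≤ C * q z s) {n m : ℕ} (hnm : n ≤ m)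
    (b : ℕ → ℝ) (z : X) : iterLim x n b z ≤ C * iterLim x m b z := by
  induction n generalizing m b z with
  | zero => exact (hqC z _).trans (mul_le_mul_of_nonneg_left (le_iterLim hx hq hq0 m b z) hC)
  | succ n ih =>
    obtain ⟨m, rfl⟩ : ∃ m', m = m' + 1 := ⟨m - 1, by omega⟩
    exact le_of_tendsto_of_tendsto' (tendsto_iterLim hx n b z)
      ((tendsto_iterLim hx m b z).const_mul C) fun i => ih (by omega) _ _

end LowerBound

include hx in
lemma exists_strictMono_tendsto_iterLim [TopologicalSpace.SeparableSpace X] :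
    ∃ k : ℕ → ℕ, StrictMono k ∧ ∀ (n : ℕ) (b : ℕ → ℝ) (z : X),
      Tendsto (fun i => iterLim x n (fun j => b (j + 1)) (z + b 0 • x (k i))) atTop
        (𝓝 (iterLim x (n + 1) b z)) := by
  let d := TopologicalSpace.denseSeq ((ℕ → ℝ) × X)
  let D : ℕ → (ℕ → ℝ) × X → ℕ → ℝ := fun n p i =>
    |iterLim x n (fun j => p.1 (j + 1)) (p.2 + p.1 0 • x i) - iterLim x (n + 1) p.1 p.2|
  have hfreq : ∀ N : ℕ, ∃ᶠ i in atTop, ∀ n ∈ Finset.range (N + 1), ∀ l ∈ Finset.range (N + 1),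
      D n (d l) i < 1 / ((N : ℝ) + 1) := fun N => by
    refine Frequently.filter_mono (Eventually.frequently ?_) Nat.hyperfilter_le_atTop
    refine (Finset.eventually_all _).2 fun n _ => (Finset.eventually_all _).2 fun l _ => ?_
    have h := ((tendsto_iterLim hx n (d l).1 (d l).2).sub_const
      (iterLim x (n + 1) (d l).1 (d l).2)).abs
    rw [sub_self, abs_zero] at h
    exact h.eventually_lt_const (by positivity)
  obtain ⟨k, hk, hkD⟩ := extraction_forall_of_frequently hfreq
  refine ⟨k, hk, fun n b z => Metric.tendsto_atTop.2 fun ε hε => ?_⟩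
  let R : (ℕ → ℝ) × X → ℝ := fun p =>
    ‖z - p.2‖ + ∑ j ∈ Finset.range (n + 1), |b j - p.1 j|
  have hR : Continuous R := by fun_prop
  obtain ⟨l, hl⟩ := (TopologicalSpace.denseRange_denseSeq ((ℕ → ℝ) × X)).exists_mem_open
    (s := {p | R p < ε / 3}) (isOpen_lt hR continuous_const)
    ⟨(b, z), by simpa [R] using hε⟩
  change R (d l) < ε / 3 at hl
  have hR' : ∀ p : (ℕ → ℝ) × X, R p =
      ‖z - p.2‖ + |b 0 - p.1 0| + ∑ j ∈ Finset.range n, |b (j + 1) - p.1 (j + 1)| := fun p => by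
    simp only [R]
    rw [Finset.sum_range_succ']
    ring
  obtain ⟨N, hN⟩ := exists_nat_one_div_lt (show 0 < ε / 3 by linarith)
  refine ⟨max N (max n l), fun i hi => ?_⟩
  have hD := hkD i n (Finset.mem_range.2 (by omega)) l (Finset.mem_range.2 (by omega))
  have hi' : 1 / ((i : ℝ) + 1) ≤ 1 / ((N : ℝ) + 1) := by
    have : N ≤ i := (le_max_left _ _).trans hi
    gcongr
  have hz : ‖z + b 0 • x (k i) - ((d l).2 + (d l).1 0 • x (k i))‖ ≤
      ‖z - (d l).2‖ + |b 0 - (d l).1 0| := by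
    rw [show z + b 0 • x (k i) - ((d l).2 + (d l).1 0 • x (k i)) =
      (z - (d l).2) + (b 0 - (d l).1 0) • x (k i) by module]
    refine (norm_add_le _ _).trans_eq ?_
    rw [norm_smul, hx, mul_one, Real.norm_eq_abs]
  have hz' := hz
  rw [norm_sub_rev] at hz'
  have e1 := iterLim_le_add hx (n + 1) b (d l).1 z (d l).2
  have e2 := iterLim_le_add hx (n + 1) (d l).1 b (d l).2 z
  have e3 := iterLim_le_add hx n (fun j => b (j + 1)) (fun j => (d l).1 (j + 1))
    (z + b 0 • x (k i)) ((d l).2 + (d l).1 0 • x (k i))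
  have e4 := iterLim_le_add hx n (fun j => (d l).1 (j + 1)) (fun j => b (j + 1))
    ((d l).2 + (d l).1 0 • x (k i)) (z + b 0 • x (k i))
  simp only [abs_sub_comm ((d l).1 _) (b _), norm_sub_rev (d l).2 z] at e2 e4
  have hRl := hR' (d l)
  change _ ≤ _ + R (d l) at e1 e2
  have hD' := abs_lt.1 hD
  rw [Real.dist_eq]
  refine abs_lt.2 ⟨?_, ?_⟩ <;> linarith

lemma iteratedLimit_iterLim {k : ℕ → ℕ}
    (hk : ∀ (n : ℕ) (b : ℕ → ℝ) (z : X),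
      Tendsto (fun i => iterLim x n (fun j => b (j + 1)) (z + b 0 • x (k i))) atTop
        (𝓝 (iterLim x (n + 1) b z))) (n : ℕ) (b : ℕ → ℝ) (z : X) :
    IteratedLimit n (fun t => ‖z + ∑ j : Fin n, b j • x (k (t j))‖) (iterLim x n b z) := by
  induction n generalizing b z with
  | zero => simp [IteratedLimit, iterLim]
  | succ n ih =>
    refine ⟨_, fun i => ?_, hk n b z⟩
    simp only [Fin.sum_univ_succ, Fin.cons_zero, Fin.cons_succ, ← add_assoc]
    exact ih (fun j => b (j + 1)) _

end IteratedUltralimit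

lemma Seminorm.exists_normedSpace {V : Type} [AddCommGroup V] [Module ℝ V] (ρ : Seminorm ℝ V) :
    ∃ (E : Type) (_ : NormedAddCommGroup E) (_ : NormedSpace ℝ E) (T : V →ₗ[ℝ] E),
      ∀ v, ‖T v‖ = ρ v := by
  let _ : SeminormedAddCommGroup V := ρ.toAddGroupSeminorm.toSeminormedAddCommGroup
  let _ : NormedSpace ℝ V := { norm_smul_le := fun a v => (map_smul_eq_mul ρ a v).le }
  exact ⟨SeparationQuotient V, inferInstance, inferInstance,
    (SeparationQuotient.mkCLM ℝ V).toLinearMap, fun v => SeparationQuotient.norm_mk v⟩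

lemma exists_norm_sum_eq_iterLim {x : ℕ → X} (hx : ∀ i, ‖x i‖ = 1) :
    ∃ (E : Type) (_ : NormedAddCommGroup E) (_ : NormedSpace ℝ E) (e : ℕ → E),
      ∀ (n : ℕ) (b : ℕ → ℝ), ‖∑ j ∈ Finset.range n, b j • e j‖ = iterLim x n b 0 := by
  let r : (ℕ →₀ ℝ) → ℝ := fun a => iterLim x (a.support.sup id + 1) a 0
  have hr : ∀ (a : ℕ →₀ ℝ) (n : ℕ), (∀ j, n ≤ j → a j = 0) → r a = iterLim x n a 0 := by
    intro a n hn
    have hsup : ∀ j, a.support.sup id + 1 ≤ j → a j = 0 := fun j hj => by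
      by_contra h
      have : j ≤ a.support.sup id := Finset.le_sup (f := id) (Finsupp.mem_support_iff.2 h)
      omega
    rcases le_total n (a.support.sup id + 1) with h | h
    · exact iterLim_eq_of_le hx h hn 0
    · exact (iterLim_eq_of_le hx h hsup 0).symm
  have hbd : ∀ a : ℕ →₀ ℝ, ∃ n, ∀ j, n ≤ j → a j = 0 := fun a => by
    obtain ⟨n, hn⟩ := a.support.exists_nat_subset_range
    refine ⟨n, fun j hj => ?_⟩
    by_contra h
    exact absurd (Finset.mem_range.1 (hn (Finsupp.mem_support_iff.2 h))) (by omega)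
  let ρ : Seminorm ℝ (ℕ →₀ ℝ) := Seminorm.of r (fun a b => by
      obtain ⟨n, hn⟩ := hbd a
      obtain ⟨m, hm⟩ := hbd b
      have h1 := hr a (max n m) fun j hj => hn j ((le_max_left _ _).trans hj)
      have h2 := hr b (max n m) fun j hj => hm j ((le_max_right _ _).trans hj)
      have h3 := hr (a + b) (max n m) fun j hj => by
        rw [Finsupp.add_apply, hn j ((le_max_left _ _).trans hj),
          hm j ((le_max_right _ _).trans hj), add_zero]
      rw [h1, h2, h3, Finsupp.coe_add]
      simpa using iterLim_add_le hx (max n m) a b 0 0) (fun c a => by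
      obtain ⟨n, hn⟩ := hbd a
      have h1 := hr (c • a) n fun j hj => by rw [Finsupp.smul_apply, hn j hj, smul_zero]
      rw [h1, hr a n hn, Finsupp.coe_smul, Real.norm_eq_abs, ← iterLim_smul hx, smul_zero])
  obtain ⟨E, i₁, i₂, T, hT⟩ := ρ.exists_normedSpace
  refine ⟨E, i₁, i₂, fun j => T (Finsupp.single j 1), fun n b => ?_⟩
  have hsum : ∀ l, (∑ j ∈ Finset.range n, b j • Finsupp.single j (1 : ℝ)) l =
      if l < n then b l else 0 := fun l => by
    simp [Finsupp.finsetSum_apply, Finsupp.single_apply]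
  simp_rw [← map_smul, ← map_sum, hT]
  refine (hr _ n fun l hl => ?_).trans (iterLim_congr n (fun l hl => ?_) 0)
  · rw [hsum, if_neg (by omega)]
  · rw [hsum, if_pos hl]

set_option maxSynthPendingDepth 3 in
theorem exists_isAsymptoticModelW_of_not_isReflexive [CompleteSpace X]
    [TopologicalSpace.SeparableSpace X] (hX : ¬ IsReflexive X) :
    ∃ (E : Type) (_ : NormedAddCommGroup E) (_ : NormedSpace ℝ E) (e : ℕ → E),
      IsAsymptoticModelW (fun z : X => ‖z‖) e ∧ 2 ≤ ‖e 0 + e 1‖ := by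
  obtain ⟨φ, δ, x, K, hφ, hδ, hδφ, hx, hxK, hlow⟩ := exists_isCBasic_of_not_isReflexive hX
  obtain ⟨k, hk, hlim⟩ := exists_strictMono_tendsto_iterLim hx
  obtain ⟨E, i₁, i₂, e, he⟩ := exists_norm_sum_eq_iterLim hx
  let q : X → ℝ → ℝ := fun z s => ‖NormedSpace.inclusionInDoubleDual ℝ X z + s • φ‖
  have hJ : ∀ z, ‖NormedSpace.inclusionInDoubleDual ℝ X z‖ = ‖z‖ :=
    (NormedSpace.inclusionInDoubleDualLi ℝ).norm_map
  have hq0 : ∀ z, q z 0 = ‖z‖ := fun z => by simp only [q, zero_smul, add_zero, hJ]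
  have hqC : ∀ z s, ‖z‖ ≤ (1 + 1 / δ) * q z s := fun z s => by
    have h1 : |s| ≤ 1 / δ * q z s := by
      rw [one_div, ← div_eq_inv_mul, le_div_iff₀' hδ]
      exact hδφ z s
    have h2 := norm_sub_le (NormedSpace.inclusionInDoubleDual ℝ X z + s • φ) (s • φ)
    rw [add_sub_cancel_right, hJ, norm_smul, hφ, mul_one, Real.norm_eq_abs] at h2
    change _ ≤ q z s + _ at h2
    linarith
  have hnorm : Normalized e := fun n => by
    rw [← iterLim_single hx n, ← he]
    simp [Pi.single_apply]
  refine ⟨E, i₁, i₂, e, ⟨hnorm, ⟨1 + 1 / δ, fun n h0 => ?_, fun n m hnm b => ?_⟩,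
    fun _ i => x (k i), ⟨K, ?_, ?_⟩, fun n b => ?_⟩, ?_⟩
  · have := hnorm n
    rw [h0, norm_zero] at this
    exact zero_ne_one this
  · rw [he, he]
    exact iterLim_le_mul hx hlow hq0 (by positivity) hqC hnm.le b 0
  · exact fun n => ⟨fun i => hx _, hxK.comp_strictMono hk⟩
  · intro m i hi _
    have h := hxK.comp_strictMono (hk.comp hi)
    exact ⟨fun j _ => h.1 j, fun n l hnl _ a => h.2 n l hnl a⟩
  · rw [he]
    simpa only [zero_add] using iteratedLimit_iterLim hlim n b 0
  · have h := le_iterLim hx hlow hq0 2 (fun _ => 1) 0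
    rw [← he] at h
    simp only [Finset.sum_range_succ, Finset.sum_range_zero, zero_add, one_smul] at h
    refine le_trans (le_of_eq ?_) h
    simp only [q]
    rw [map_zero, zero_add, norm_smul, hφ]
    norm_num

namespace EquivNorm

/-- The space `X` renormed by `N`. -/
def Renormed (_ : EquivNorm X) : Type _ := X

variable (N : EquivNorm X)

instance : AddCommGroup N.Renormed := inferInstanceAs (AddCommGroup X)

instance : Module ℝ N.Renormed := inferInstanceAs (Module ℝ X)

noncomputable instance : NormedAddCommGroup N.Renormed :=
  AddGroupNorm.toNormedAddCommGroup
    { toFun := N.toFun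
      map_zero' := N.map_zero
      add_le' := N.add_le'
      neg' := N.map_neg
      eq_zero_of_map_eq_zero' := fun _ => N.eq_zero }

noncomputable instance : NormedSpace ℝ N.Renormed where
  norm_smul_le a x := (N.smul' a x).le

lemma nonempty_continuousLinearEquiv : Nonempty (X ≃L[ℝ] N.Renormed) := by
  obtain ⟨A, hA, hlow⟩ := N.lower'
  obtain ⟨B, hB, hup⟩ := N.upper'
  let T : X ≃ₗ[ℝ] N.Renormed := LinearEquiv.refl ℝ X
  exact ⟨T.toContinuousLinearEquivOfBounds B A⁻¹ hup fun x => by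
    rw [← div_eq_inv_mul, le_div_iff₀' hA]; exact hlow x⟩

end EquivNorm

lemma IsReflexive.of_continuousLinearEquiv {Y : Type*} [NormedAddCommGroup Y] [NormedSpace ℝ Y]
    (T : X ≃L[ℝ] Y) (hY : IsReflexive Y) : IsReflexive X := by
  intro Φ
  let P : StrongDual ℝ Y →L[ℝ] StrongDual ℝ X :=
    (ContinuousLinearMap.compL ℝ X Y ℝ).flip (T : X →L[ℝ] Y)
  obtain ⟨y, hy⟩ := hY (Φ ∘L P)
  refine ⟨T.symm y, ?_⟩
  ext f
  have h := congrArg (fun Ψ => Ψ (f ∘L (T.symm : Y →L[ℝ] X))) hy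
  simp only [NormedSpace.dual_def, ContinuousLinearMap.comp_apply] at h ⊢
  refine Eq.trans h (congrArg Φ ?_)
  ext x
  simp [P]

/-- Corollary 4.6: `X` is reflexive iff it has an equivalent norm `N` such that every
asymptotic model `e` of `(X, N)` satisfies `‖e 0 + e 1‖ < 2`. -/
theorem stmt_17 (X : Type*) [NormedAddCommGroup X] [NormedSpace ℝ X] [CompleteSpace X]
    [TopologicalSpace.SeparableSpace X] (hinf : ¬ FiniteDimensional ℝ X) :
    IsReflexive X ↔
      ∃ N : EquivNorm X,
        ∀ (E : Type) [NormedAddCommGroup E] [NormedSpace ℝ E] (e : ℕ → E),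
          IsAsymptoticModelW N.toFun e → ‖e 0 + e 1‖ < 2 := by

  refine ⟨fun hX => hX.exists_equivNorm, fun ⟨N, hN⟩ => ?_⟩
  obtain ⟨T⟩ := N.nonempty_continuousLinearEquiv
  refine IsReflexive.of_continuousLinearEquiv T ?_
  have : CompleteSpace N.Renormed :=
    (T.isUniformEmbedding.isUniformInducing.completeSpace_congr T.surjective).1 inferInstance
  have : TopologicalSpace.SeparableSpace N.Renormed :=
    T.surjective.denseRange.separableSpace T.continuous
  by_contra h
  obtain ⟨E, i₁, i₂, e, he, hle⟩ := exists_isAsymptoticModelW_of_not_isReflexive h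
  exact absurd (hN E e he) hle.not_gt
end

section
/- Let (X, ‖·‖) be a separable Banach space and let |||·||| be the asymptotic norm generated by ‖·‖ (via a countable dense set C and weights (p_c)). Let (x_m)_{m∈ω} and (y_n)_{n∈ω} be |||·|||-normalized sequences in X. (a) If lim_{m→∞} lim_{n→∞} |||x_m + y_n||| = 2, then there exist integers k(0) < k(1) < ⋯ such that, setting x'_m := x_{k(m)}/‖x_{k(m)}‖ and y'_n := y_{k(n)}/‖y_{k(n)}‖, for all y ∈ X and all β₁, β₂ ≥ 0 not both zero: lim_{m→∞} lim_{n→∞} ‖y + β₁ x'_m + β₂ y'_n‖ = lim_{m→∞} ‖(β₁/(β₁+β₂)) y + β₁ x'_m‖ + lim_{n→∞} ‖(β₂/(β₁+β₂)) y + β₂ y'_n‖. (b) If moreover lim_{m→∞} lim_{n→∞} |||x_m − y_n||| = 2 as well, then the integers can be chosen so that for all y ∈ X and all real β₁, β₂ not both zero: lim_{m→∞} lim_{n→∞} ‖y + β₁ x'_m + β₂ y'_n‖ = lim_{m→∞} ‖(|β₁|/(|β₁|+|β₂|)) y + β₁ x'_m‖ + lim_{n→∞} ‖(|β₂|/(|β₁|+|β₂|))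 y + β₂ y'_n‖. -/
open Filter Finset Topology

variable {X : Type*} [NormedAddCommGroup X] [NormedSpace ℝ X]

/-- The norm `‖x‖_c = ‖c‖x‖ + x‖ + ‖c‖x‖ - x‖` summed with weights `p c` over the countable
dense set `C`: the asymptotic norm `|||·|||` generated by `‖·‖`. -/
noncomputable def tripNorm (C : Set X) (p : X → ℝ) (x : X) : ℝ :=
  ∑' c : C, p (c : X) * (‖‖x‖ • (c : X) + x‖ + ‖‖x‖ • (c : X) - x‖)

/-- The defect in the triangle inequality for `u + v`. -/
noncomputable def normDefect {E : Type*} [NormedAddCommGroup E] (u v : E) : ℝ :=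
  ‖u‖ + ‖v‖ - ‖u + v‖

lemma normDefect_nonneg {E : Type*} [NormedAddCommGroup E] (u v : E) : 0 ≤ normDefect u v :=
  sub_nonneg.2 (norm_add_le u v)

lemma normDefect_neg_neg {E : Type*} [NormedAddCommGroup E] (u v : E) :
    normDefect (-u) (-v) = normDefect u v := by
  simp only [normDefect, ← neg_add, norm_neg]

lemma normDefect_smul_smul_le {s t M : ℝ} (hs : 0 ≤ s) (ht : 0 ≤ t) (hsM : s ≤ M) (htM : t ≤ M)
    (u v : X) : normDefect (s • u) (t • v) ≤ M * normDefect u v := by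
  have hM : 0 ≤ M := hs.trans hsM
  have key : M • (u + v) = (s • u + t • v) + (M - s) • u + (M - t) • v := by module
  have h : M * ‖u + v‖ ≤ ‖s • u + t • v‖ + (M - s) * ‖u‖ + (M - t) * ‖v‖ := by
    rw [← norm_smul_of_nonneg hM, key, ← norm_smul_of_nonneg (sub_nonneg.2 hsM),
      ← norm_smul_of_nonneg (sub_nonneg.2 htM)]
    exact norm_add₃_le
  simp only [normDefect, norm_smul_of_nonneg hs, norm_smul_of_nonneg ht]
  linarith

lemma normDefect_le_add {E : Type*} [NormedAddCommGroup E] (u v u' v' : E) :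
    normDefect u v ≤ normDefect u' v' + 2 * (‖u - u'‖ + ‖v - v'‖) := by
  have h1 := norm_le_norm_add_norm_sub' u u'
  have h2 := norm_le_norm_add_norm_sub' v v'
  have h3 : ‖u' + v'‖ ≤ ‖u + v‖ + ‖u - u'‖ + ‖v - v'‖ := by
    rw [norm_sub_rev u, norm_sub_rev v]
    calc ‖u' + v'‖ = ‖(u + v) + (u' - u) + (v' - v)‖ := by congr 1; abel
      _ ≤ _ := norm_add₃_le
  simp only [normDefect]
  linarith

lemma norm_add_add_norm_sub_mono {s t : ℝ} (hs : 0 ≤ s) (hst : s ≤ t) (c z : X) :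
    ‖s • c + z‖ + ‖s • c - z‖ ≤ ‖t • c + z‖ + ‖t • c - z‖ := by
  rcases hs.eq_or_lt with rfl | hs
  · have h : ‖(2 : ℝ) • z‖ ≤ ‖t • c + z‖ + ‖t • c - z‖ := by
      rw [show (2 : ℝ) • z = (t • c + z) - (t • c - z) by module]
      exact norm_sub_le _ _
    rw [norm_smul_of_nonneg zero_le_two] at h
    simp only [zero_smul, zero_add, zero_sub, norm_neg]
    linarith
  · have ht : 0 < t := hs.trans_le hst
    obtain ⟨a, b, ha0, hb0, hab, hs'⟩ :
        ∃ a b : ℝ, 0 ≤ a ∧ 0 ≤ b ∧ a + b = 1 ∧ s = (a - b) * t := by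
      refine ⟨(t + s) / (2 * t), (t - s) / (2 * t), by positivity,
        div_nonneg (by linarith) (by positivity), ?_, ?_⟩ <;> field_simp <;> ring
    have hz : z = (a + b) • z := by rw [hab, one_smul]
    have h1 : s • c + z = a • (t • c + z) - b • (t • c - z) := by
      trans ((a - b) * t) • c + (a + b) • z
      · rw [← hs', ← hz]
      · module
    have h2 : s • c - z = a • (t • c - z) - b • (t • c + z) := by
      trans ((a - b) * t) • c - (a + b) • z
      · rw [← hs', ← hz]
      · module
    have n1 := norm_sub_le (a • (t • c + z)) (b • (t • c - z))
    have n2 := norm_sub_le (a • (t • c - z)) (b • (t • c + z))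
    rw [← h1, norm_smul_of_nonneg ha0, norm_smul_of_nonneg hb0] at n1
    rw [← h2, norm_smul_of_nonneg ha0, norm_smul_of_nonneg hb0] at n2
    have h3 : ‖t • c + z‖ + ‖t • c - z‖ = (a + b) * ‖t • c + z‖ + (a + b) * ‖t • c - z‖ := by
      rw [hab]; ring
    linarith

/-- The norm `‖·‖_c` generating the asymptotic norm. -/
noncomputable def symmNorm (c x : X) : ℝ := ‖‖x‖ • c + x‖ + ‖‖x‖ • c - x‖

lemma symmNorm_nonneg (c x : X) : 0 ≤ symmNorm c x := by
  unfold symmNorm; positivity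

lemma symmNorm_le (c x : X) : symmNorm c x ≤ 2 * (1 + ‖c‖) * ‖x‖ := by
  have h1 := norm_add_le (‖x‖ • c) x
  have h2 := norm_sub_le (‖x‖ • c) x
  rw [norm_smul, norm_norm] at h1 h2
  unfold symmNorm
  linarith

lemma normDefect_add_normDefect_le (c x y : X) :
    normDefect (‖x‖ • c + x) (‖y‖ • c + y) + normDefect (‖x‖ • c - x) (‖y‖ • c - y) ≤
      symmNorm c x + symmNorm c y - symmNorm c (x + y) := by
  have h := norm_add_add_norm_sub_mono (norm_nonneg _) (norm_add_le x y) c (x + y)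
  have e1 : (‖x‖ • c + x) + (‖y‖ • c + y) = (‖x‖ + ‖y‖) • c + (x + y) := by module
  have e2 : (‖x‖ • c - x) + (‖y‖ • c - y) = (‖x‖ + ‖y‖) • c - (x + y) := by module
  simp only [normDefect, symmNorm, e1, e2]
  linarith

section tripNorm

variable {C : Set X} {p : X → ℝ}

lemma summable_mul_symmNorm (hp : ∀ c ∈ C, 0 < p c)
    (hsum : Summable fun c : C => p (c : X) * (1 + ‖(c : X)‖)) (x : X) :
    Summable fun c : C => p (c : X) * symmNorm (c : X) x := by
  refine Summable.of_nonneg_of_le (fun c => mul_nonneg (hp c c.2).le (symmNorm_nonneg _ _))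
    (fun c => ?_) (hsum.mul_right (2 * ‖x‖))
  have := mul_le_mul_of_nonneg_left (symmNorm_le (c : X) x) (hp c c.2).le
  linarith

lemma tripNorm_le (hp : ∀ c ∈ C, 0 < p c)
    (hsum : Summable fun c : C => p (c : X) * (1 + ‖(c : X)‖)) (x : X) :
    tripNorm C p x ≤ (∑' c : C, p (c : X) * (1 + ‖(c : X)‖)) * 2 * ‖x‖ := by
  rw [mul_assoc, ← tsum_mul_right]
  refine (summable_mul_symmNorm hp hsum x).tsum_le_tsum (fun c => ?_) (hsum.mul_right _)
  change p (c : X) * symmNorm (c : X) x ≤ _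
  have := mul_le_mul_of_nonneg_left (symmNorm_le (c : X) x) (hp c c.2).le
  linarith

lemma mul_normDefect_le_tripNorm (hp : ∀ c ∈ C, 0 < p c)
    (hsum : Summable fun c : C => p (c : X) * (1 + ‖(c : X)‖)) {c : X} (hc : c ∈ C) (x y : X) :
    p c * (normDefect (‖x‖ • c + x) (‖y‖ • c + y) + normDefect (‖x‖ • c - x) (‖y‖ • c - y)) ≤
      tripNorm C p x + tripNorm C p y - tripNorm C p (x + y) := by
  have hs := summable_mul_symmNorm hp hsum
  have hsum' := (((hs x).hasSum.add (hs y).hasSum).sub (hs (x + y)).hasSum)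
  have hle (d : C) : p d * (normDefect (‖x‖ • (d : X) + x) (‖y‖ • (d : X) + y) +
      normDefect (‖x‖ • (d : X) - x) (‖y‖ • (d : X) - y)) ≤
      p d * symmNorm (d : X) x + p d * symmNorm (d : X) y - p d * symmNorm (d : X) (x + y) := by
    have := mul_le_mul_of_nonneg_left (normDefect_add_normDefect_le (d : X) x y) (hp d d.2).le
    linarith
  refine (hle ⟨c, hc⟩).trans (le_hasSum hsum' _ fun d _ => le_trans ?_ (hle d))
  exact mul_nonneg (hp d d.2).le (add_nonneg (normDefect_nonneg _ _) (normDefect_nonneg _ _))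

end tripNorm

lemma IterLim2.tendsto_curry {F : ℕ → ℕ → ℝ} {L : ℝ} (h : IterLim2 F L) :
    Tendsto (fun q : ℕ × ℕ => F q.1 q.2) (atTop.curry atTop) (𝓝 L) := by
  obtain ⟨g, hF, hg⟩ := h
  rw [Metric.tendsto_nhds]
  intro ε hε
  rw [Filter.eventually_curry_iff]
  filter_upwards [Metric.tendsto_nhds.1 hg (ε / 2) (half_pos hε)] with m hm
  filter_upwards [Metric.tendsto_nhds.1 (hF m) (ε / 2) (half_pos hε)] with n hn
  linarith [dist_triangle (F m n) (g m) L]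

lemma IterLim2.of_tendsto_curry {F : ℕ → ℕ → ℝ} {L : ℝ}
    (h : Tendsto (fun q : ℕ × ℕ => F q.1 q.2) (atTop.curry atTop) (𝓝 L))
    (hF : ∀ m, ∃ l, Tendsto (F m) atTop (𝓝 l)) : IterLim2 F L := by
  choose g hg using hF
  refine ⟨g, hg, Metric.tendsto_nhds.2 fun ε hε => ?_⟩
  have h' := Metric.tendsto_nhds.1 h (ε / 2) (half_pos hε)
  rw [Filter.eventually_curry_iff] at h'
  filter_upwards [h'] with m hm
  have := le_of_tendsto ((hg m).dist tendsto_const_nhds) (hm.mono fun n hn => le_of_lt hn)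
  linarith

lemma tendsto_prodMap_curry_atTop {k : ℕ → ℕ} (hk : StrictMono k) :
    Tendsto (Prod.map k k) (atTop.curry atTop) (atTop.curry atTop) := by
  intro s hs
  have hs' : ∀ᶠ q in atTop.curry atTop, q ∈ s := hs
  rw [Filter.eventually_curry_iff] at hs'
  change ∀ᶠ q in atTop.curry atTop, Prod.map k k q ∈ s
  rw [Filter.eventually_curry_iff]
  filter_upwards [hk.tendsto_atTop.eventually hs'] with m hm
  exact hk.tendsto_atTop.eventually hm

/-- A bounded sequence in a separable space has a subsequence generating a type. -/
lemma exists_strictMono_tendsto_norm_add {E : Type*} [NormedAddCommGroup E]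
    [TopologicalSpace.SeparableSpace E] {u : ℕ → E} (hu : ∀ m, ‖u m‖ ≤ 1) :
    ∃ k : ℕ → ℕ, StrictMono k ∧ ∀ z : E, ∃ l, Tendsto (fun m => ‖z + u (k m)‖) atTop (𝓝 l) := by
  let d := TopologicalSpace.denseSeq E
  have hK : IsCompact (Set.pi Set.univ fun i => Set.Icc (0 : ℝ) (‖d i‖ + 1)) :=
    isCompact_univ_pi fun i => isCompact_Icc
  obtain ⟨a, -, k, hk, ha⟩ := hK.tendsto_subseq (x := fun m i => ‖d i + u m‖) fun m i _ =>
    ⟨norm_nonneg _, (norm_add_le _ _).trans (add_le_add_right (hu m) _)⟩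
  refine ⟨k, hk, fun z => cauchySeq_tendsto_of_complete (Metric.cauchySeq_iff.2 fun ε hε => ?_)⟩
  obtain ⟨i, hi⟩ := (TopologicalSpace.denseRange_denseSeq E).exists_dist_lt z
    (show 0 < ε / 3 by positivity)
  obtain ⟨N, hN⟩ := Metric.cauchySeq_iff.1 (tendsto_pi_nhds.1 ha i).cauchySeq (ε / 3)
    (by positivity)
  refine ⟨N, fun m hm n hn => ?_⟩
  have hd (j : ℕ) : dist ‖z + u j‖ ‖d i + u j‖ < ε / 3 :=
    (dist_norm_norm_le _ _).trans_lt (by rwa [add_sub_add_right_eq_sub, ← dist_eq_norm])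
  have h1 := hd (k m)
  have h2 := hd (k n)
  rw [dist_comm] at h2
  have h3 := hN m hm n hn
  simp only [Function.comp_apply] at h3
  linarith [dist_triangle4 ‖z + u (k m)‖ ‖d i + u (k m)‖ ‖d i + u (k n)‖ ‖z + u (k n)‖]

lemma exists_strictMono_tendsto_norm_add₂ {E : Type*} [NormedAddCommGroup E]
    [TopologicalSpace.SeparableSpace E] {u v : ℕ → E}
    (hu : ∀ m, ‖u m‖ ≤ 1) (hv : ∀ m, ‖v m‖ ≤ 1) :
    ∃ k : ℕ → ℕ, StrictMono k ∧
      (∀ z : E, ∃ l, Tendsto (fun m => ‖z + u (k m)‖) atTop (𝓝 l)) ∧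
      ∀ z : E, ∃ l, Tendsto (fun m => ‖z + v (k m)‖) atTop (𝓝 l) := by
  obtain ⟨k, hk, h1⟩ := exists_strictMono_tendsto_norm_add hu
  obtain ⟨j, hj, h2⟩ := exists_strictMono_tendsto_norm_add (u := v ∘ k) fun m => hv (k m)
  exact ⟨k ∘ j, hk.comp hj,
    fun z => (h1 z).imp fun l hl => hl.comp hj.tendsto_atTop, h2⟩

lemma exists_tendsto_norm_add_smul {u : ℕ → X}
    (hu : ∀ z : X, ∃ l, Tendsto (fun m => ‖z + u m‖) atTop (𝓝 l)) (z : X) (β : ℝ) :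
    ∃ l, Tendsto (fun m => ‖z + β • u m‖) atTop (𝓝 l) := by
  rcases eq_or_ne β 0 with rfl | hβ
  · exact ⟨‖z‖, by simp⟩
  · obtain ⟨l, hl⟩ := hu (β⁻¹ • z)
    refine ⟨‖β‖ * l, (hl.const_mul ‖β‖).congr fun m => ?_⟩
    rw [← norm_smul, smul_add, smul_inv_smul₀ hβ]

/-- Asymptotic additivity of the norm gives the iterated limit formula for types. -/
lemma exists_iterLim2_of_tendsto_normDefect {u v : ℕ → X} {β₁ β₂ : ℝ} (hβ : ¬(β₁ = 0 ∧ β₂ = 0))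
    {k : ℕ → ℕ} (hk : StrictMono k)
    (hu : ∀ z : X, ∃ l, Tendsto (fun m => ‖z + u (k m)‖) atTop (𝓝 l))
    (hv : ∀ z : X, ∃ l, Tendsto (fun m => ‖z + v (k m)‖) atTop (𝓝 l))
    (h : ∀ c : X, Tendsto (fun q : ℕ × ℕ =>
      normDefect (|β₁| • c + β₁ • u q.1) (|β₂| • c + β₂ • v q.2)) (atTop.curry atTop) (𝓝 0))
    (z : X) :
    ∃ L₁ L₂ : ℝ,
      Tendsto (fun m => ‖(|β₁| / (|β₁| + |β₂|)) • z + β₁ • u (k m)‖) atTop (𝓝 L₁) ∧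
      Tendsto (fun n => ‖(|β₂| / (|β₁| + |β₂|)) • z + β₂ • v (k n)‖) atTop (𝓝 L₂) ∧
      IterLim2 (fun m n => ‖z + β₁ • u (k m) + β₂ • v (k n)‖) (L₁ + L₂) := by
  have hpos : |β₁| + |β₂| ≠ 0 := fun h0 => hβ
    ⟨abs_eq_zero.1 (by linarith [abs_nonneg β₁, abs_nonneg β₂]),
      abs_eq_zero.1 (by linarith [abs_nonneg β₁, abs_nonneg β₂])⟩
  obtain ⟨L₁, h₁⟩ := exists_tendsto_norm_add_smul hu ((|β₁| / (|β₁| + |β₂|)) • z) β₁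
  obtain ⟨L₂, h₂⟩ := exists_tendsto_norm_add_smul hv ((|β₂| / (|β₁| + |β₂|)) • z) β₂
  refine ⟨L₁, L₂, h₁, h₂, .of_tendsto_curry ?_ fun m => exists_tendsto_norm_add_smul hv _ _⟩
  have hfst : Tendsto Prod.fst ((atTop : Filter ℕ).curry (atTop : Filter ℕ)) atTop :=
    tendsto_fst.mono_left curry_le_prod
  have hsnd : Tendsto Prod.snd ((atTop : Filter ℕ).curry (atTop : Filter ℕ)) atTop :=
    tendsto_snd.mono_left curry_le_prod
  have hd := (h ((|β₁| + |β₂|)⁻¹ • z)).comp (tendsto_prodMap_curry_atTop hk)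
  have := ((h₁.comp hfst).add (h₂.comp hsnd)).sub hd
  rw [sub_zero] at this
  refine this.congr fun q => ?_
  have hz : z = (|β₁| / (|β₁| + |β₂|)) • z + (|β₂| / (|β₁| + |β₂|)) • z := by
    rw [← add_smul, ← add_div, div_self hpos, one_smul]
  simp only [Function.comp_apply, normDefect, Prod.map_fst, Prod.map_snd, smul_smul,
    ← div_eq_mul_inv, sub_sub_cancel]
  conv_rhs => rw [hz]
  congr 1
  abel

/-- If `|||x_m + y_n||| → 2` for normalized sequences, then `‖·‖` is asymptotically additive on
the translates of nonnegative multiples of the renormalized sequences. -/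
lemma tendsto_normDefect_of_iterLim2 {C : Set X} (hCd : Dense C) {p : X → ℝ}
    (hp : ∀ c ∈ C, 0 < p c) (hsum : Summable fun c : C => p (c : X) * (1 + ‖(c : X)‖))
    {x y : ℕ → X} (hx : ∀ m, tripNorm C p (x m) = 1) (hy : ∀ n, tripNorm C p (y n) = 1)
    (h : IterLim2 (fun m n => tripNorm C p (x m + y n)) 2) {s t : ℝ} (hs : 0 ≤ s) (ht : 0 ≤ t)
    (c : X) :
    Tendsto (fun q : ℕ × ℕ => normDefect (s • c + s • (‖x q.1‖⁻¹ • x q.1))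
      (t • c + t • (‖y q.2‖⁻¹ • y q.2))) (atTop.curry atTop) (𝓝 0) := by
  set K := (∑' c : C, p (c : X) * (1 + ‖(c : X)‖)) * 2
  have hbound (w : X) (hw : tripNorm C p w = 1) : 0 < ‖w‖ ∧ ‖w‖⁻¹ ≤ K := by
    have hle : 1 ≤ K * ‖w‖ := hw ▸ tripNorm_le hp hsum w
    have hne : 0 < ‖w‖ := (norm_nonneg w).lt_of_ne fun h0 => by
      rw [← h0, mul_zero] at hle; linarith
    exact ⟨hne, by rwa [inv_le_iff_one_le_mul₀ hne]⟩
  have hK0 : 0 ≤ K := (inv_nonneg.2 (norm_nonneg _)).trans (hbound _ (hx 0)).2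
  set M := (s + t) * K
  have hC (c : X) (hc : c ∈ C) : Tendsto (fun q : ℕ × ℕ =>
      normDefect (s • c + s • (‖x q.1‖⁻¹ • x q.1)) (t • c + t • (‖y q.2‖⁻¹ • y q.2)))
      (atTop.curry atTop) (𝓝 0) := by
    have hlim : Tendsto (fun q : ℕ × ℕ => M / p c * (2 - tripNorm C p (x q.1 + y q.2)))
        (atTop.curry atTop) (𝓝 0) := by
      simpa using (h.tendsto_curry.const_sub 2).const_mul (M / p c)
    refine squeeze_zero (fun q => normDefect_nonneg _ _) (fun q => ?_) hlim
    obtain ⟨hx0, hxK⟩ := hbound _ (hx q.1)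
    obtain ⟨hy0, hyK⟩ := hbound _ (hy q.2)
    have e (r : ℝ) (w : X) (hw : 0 < ‖w‖) :
        r • c + r • (‖w‖⁻¹ • w) = (r * ‖w‖⁻¹) • (‖w‖ • c + w) := by
      rw [mul_smul, smul_add, inv_smul_smul₀ hw.ne', smul_add]
    have hsM : s * ‖x q.1‖⁻¹ ≤ M := mul_le_mul (by linarith) hxK (by positivity) (by positivity)
    have htM : t * ‖y q.2‖⁻¹ ≤ M := mul_le_mul (by linarith) hyK (by positivity) (by positivity)
    have hpc := hp c hc
    have hM0 : 0 ≤ M := by positivity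
    rw [e s _ hx0, e t _ hy0]
    refine (normDefect_smul_smul_le (by positivity) (by positivity) hsM htM _ _).trans ?_
    rw [div_mul_eq_mul_div, mul_div_assoc]
    refine mul_le_mul_of_nonneg_left ?_ hM0
    rw [le_div_iff₀ hpc]
    have h1 := mul_normDefect_le_tripNorm hp hsum hc (x q.1) (y q.2)
    rw [hx, hy, mul_add] at h1
    have h2 := mul_nonneg hpc.le
      (normDefect_nonneg (‖x q.1‖ • c - x q.1) (‖y q.2‖ • c - y q.2))
    linarith
  rw [Metric.tendsto_nhds]
  intro ε hε
  obtain ⟨d, hd, hdist⟩ := hCd.exists_dist_lt c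
    (show 0 < ε / (4 * (s + t + 1)) by positivity)
  filter_upwards [Metric.tendsto_nhds.1 (hC d hd) (ε / 2) (half_pos hε)] with q hq
  rw [Real.dist_0_eq_abs, abs_of_nonneg (normDefect_nonneg _ _)] at hq ⊢
  refine (normDefect_le_add _ _ _ _).trans_lt (add_lt_add_of_lt_of_le hq ?_) |>.trans_eq
    (add_halves ε)
  rw [add_sub_add_right_eq_sub, add_sub_add_right_eq_sub, ← smul_sub, ← smul_sub,
    norm_smul_of_nonneg hs, norm_smul_of_nonneg ht, ← dist_eq_norm]
  rw [lt_div_iff₀ (by positivity)] at hdist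
  nlinarith [dist_nonneg (x := c) (y := d)]

/-- Lemma 4.7 a) and b). -/
theorem stmt_18 {X : Type*} [NormedAddCommGroup X] [NormedSpace ℝ X] [CompleteSpace X]
    [TopologicalSpace.SeparableSpace X]
    (C : Set X) (hCc : C.Countable) (hCd : Dense C)
    (p : X → ℝ) (hp : ∀ c ∈ C, 0 < p c)
    (hsum : Summable fun c : C => p (c : X) * (1 + ‖(c : X)‖))
    (x y : ℕ → X) (hx : ∀ m, tripNorm C p (x m) = 1) (hy : ∀ n, tripNorm C p (y n) = 1) :
    (IterLim2 (fun m n => tripNorm C p (x m + y n)) 2 →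
      ∃ k : ℕ → ℕ, StrictMono k ∧
        ∀ (y₀ : X) (β₁ β₂ : ℝ), 0 ≤ β₁ → 0 ≤ β₂ → ¬(β₁ = 0 ∧ β₂ = 0) →
          ∃ L₁ L₂ : ℝ,
            Filter.Tendsto
              (fun m => ‖(β₁ / (β₁ + β₂)) • y₀ + β₁ • (‖x (k m)‖⁻¹ • x (k m))‖)
              Filter.atTop (nhds L₁) ∧
            Filter.Tendsto
              (fun n => ‖(β₂ / (β₁ + β₂)) • y₀ + β₂ • (‖y (k n)‖⁻¹ • y (k n))‖)
              Filter.atTop (nhds L₂) ∧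
            IterLim2
              (fun m n =>
                ‖y₀ + β₁ • (‖x (k m)‖⁻¹ • x (k m)) + β₂ • (‖y (k n)‖⁻¹ • y (k n))‖)
              (L₁ + L₂)) ∧
    (IterLim2 (fun m n => tripNorm C p (x m + y n)) 2 →
      IterLim2 (fun m n => tripNorm C p (x m - y n)) 2 →
      ∃ k : ℕ → ℕ, StrictMono k ∧
        ∀ (y₀ : X) (β₁ β₂ : ℝ), ¬(β₁ = 0 ∧ β₂ = 0) →
          ∃ L₁ L₂ : ℝ,
            Filter.Tendsto
              (fun m => ‖(|β₁| / (|β₁| + |β₂|)) • y₀ + β₁ • (‖x (k m)‖⁻¹ • x (k m))‖)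
              Filter.atTop (nhds L₁) ∧
            Filter.Tendsto
              (fun n => ‖(|β₂| / (|β₁| + |β₂|)) • y₀ + β₂ • (‖y (k n)‖⁻¹ • y (k n))‖)
              Filter.atTop (nhds L₂) ∧
            IterLim2
              (fun m n =>
                ‖y₀ + β₁ • (‖x (k m)‖⁻¹ • x (k m)) + β₂ • (‖y (k n)‖⁻¹ • y (k n))‖)
              (L₁ + L₂)) := by
  have hunit (w : X) : ‖‖w‖⁻¹ • w‖ ≤ 1 := by
    rw [norm_smul, norm_inv, norm_norm]
    exact inv_mul_le_one
  obtain ⟨k, hk, hu, hv⟩ := exists_strictMono_tendsto_norm_add₂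
    (fun m => hunit (x m)) (fun n => hunit (y n))
  refine ⟨fun h => ⟨k, hk, fun y₀ β₁ β₂ h₁ h₂ hβ => ?_⟩,
    fun h h' => ⟨k, hk, fun y₀ β₁ β₂ hβ => ?_⟩⟩
  · have := exists_iterLim2_of_tendsto_normDefect (u := fun m => ‖x m‖⁻¹ • x m)
      (v := fun n => ‖y n‖⁻¹ • y n) hβ hk hu hv (fun c => by
      rw [abs_of_nonneg h₁, abs_of_nonneg h₂]
      exact tendsto_normDefect_of_iterLim2 hCd hp hsum hx hy h h₁ h₂ c) y₀
    rwa [abs_of_nonneg h₁, abs_of_nonneg h₂] at this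
  · refine exists_iterLim2_of_tendsto_normDefect (u := fun m => ‖x m‖⁻¹ • x m)
      (v := fun n => ‖y n‖⁻¹ • y n) hβ hk hu hv (fun c => ?_) y₀
    have hplus := fun c => tendsto_normDefect_of_iterLim2 hCd hp hsum hx hy h
      (abs_nonneg β₁) (abs_nonneg β₂) c
    have hneg (w : X) : tripNorm C p (-w) = tripNorm C p w := by
      simp only [tripNorm, norm_neg, ← sub_eq_add_neg, sub_neg_eq_add]
      exact tsum_congr fun c => by rw [add_comm ‖_ - w‖]
    have hminus := fun c => tendsto_normDefect_of_iterLim2 (y := fun n => -y n) hCd hp hsum hx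
      (fun n => (hneg _).trans (hy n)) (by simpa only [← sub_eq_add_neg] using h')
      (abs_nonneg β₁) (abs_nonneg β₂) c
    rcases abs_cases β₁ with ⟨e₁, -⟩ | ⟨e₁, -⟩ <;> rcases abs_cases β₂ with ⟨e₂, -⟩ | ⟨e₂, -⟩ <;>
      rw [e₁, e₂] at hplus hminus ⊢
    · exact hplus c
    · refine (hminus c).congr fun q => ?_
      simp only [norm_neg, smul_neg, neg_smul, neg_neg]
    · refine (hminus (-c)).congr fun q => ?_
      rw [← normDefect_neg_neg, norm_neg]
      congr 1 <;> module
    · refine (hplus (-c)).congr fun q => ?_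
      rw [← normDefect_neg_neg]
      congr 1 <;> module
end

section
/- Let X be a Banach space with a basis (b_i)_{i∈ω}. There exists an equivalent norm ||||·|||| on X such that: if (x_m)_{m∈ω} and (y_n)_{n∈ω} are ||||·||||-normalized block bases of (b_i)_{i∈ω} satisfying lim_{m→∞} lim_{n→∞} ||||x_m + y_n|||| = 2 and lim_{m→∞} lim_{n→∞} ||||x_m − y_n|||| = 2, then X contains a subspace isomorphic to ℓ₁. -/
open Filter Finset Topology

variable {X : Type*} [NormedAddCommGroup X] [NormedSpace ℝ X]
variable {E : Type*} [NormedAddCommGroup E] [NormedSpace ℝ E]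

/-- `b` is a (Schauder) basis of the space. -/
def IsSchauderBasis (b : ℕ → X) : Prop :=
  (∃ C : ℝ, IsCBasic C b) ∧ Dense (Submodule.span ℝ (Set.range b) : Set X)

/-- `y` is a block basis of `x`. -/
def IsBlockBasisOf (x y : ℕ → X) : Prop :=
  ∃ (p : ℕ → ℕ) (b : ℕ → ℝ), StrictMono p ∧ (∀ j, y j ≠ 0) ∧
    ∀ j, y j = ∑ l ∈ Finset.Ico (p j) (p (j + 1)), b l • x l

/-- The seminorm `x ↦ ‖‖x‖ • c + x‖ + ‖‖x‖ • c - x‖`. -/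
noncomputable def twistSeminorm (c : X) : Seminorm ℝ X :=
  Seminorm.of (fun x => ‖‖x‖ • c + x‖ + ‖‖x‖ • c - x‖)
    (by
      have mono : ∀ (z : X) (s t : ℝ), 0 ≤ s → s ≤ t →
          ‖s • c + z‖ + ‖s • c - z‖ ≤ ‖t • c + z‖ + ‖t • c - z‖ := by
        intro z s t hs hst
        rcases (hs.trans hst).eq_or_lt with ht | ht
        · rw [le_antisymm (ht ▸ hst) hs, ← ht]
        set r := s / t with hr
        have hr0 : 0 ≤ r := by positivity
        have hr1 : r ≤ 1 := (div_le_one ht).2 hst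
        have hsr : s = r * t := by rw [hr]; field_simp
        have e1 : s • c + z = ((1 + r) / 2) • (t • c + z) + (-((1 - r) / 2)) • (t • c - z) := by
          rw [hsr]; module
        have e2 : s • c - z = (-((1 - r) / 2)) • (t • c + z) + ((1 + r) / 2) • (t • c - z) := by
          rw [hsr]; module
        have h1 : |(1 + r) / 2| = (1 + r) / 2 := abs_of_nonneg (by linarith)
        have h2 : |-((1 - r) / 2)| = (1 - r) / 2 := by
          rw [abs_neg]; exact abs_of_nonneg (by linarith)
        have n1 := norm_add_le (((1 + r) / 2) • (t • c + z)) ((-((1 - r) / 2)) • (t • c - z))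
        have n2 := norm_add_le ((-((1 - r) / 2)) • (t • c + z)) (((1 + r) / 2) • (t • c - z))
        rw [← e1, norm_smul, norm_smul, Real.norm_eq_abs, Real.norm_eq_abs, h1, h2] at n1
        rw [← e2, norm_smul, norm_smul, Real.norm_eq_abs, Real.norm_eq_abs, h1, h2] at n2
        linarith
      intro x y
      refine (mono (x + y) _ _ (norm_nonneg _) (norm_add_le x y)).trans ?_
      have n1 := norm_add_le (‖x‖ • c + x) (‖y‖ • c + y)
      have n2 := norm_add_le (‖x‖ • c - x) (‖y‖ • c - y)
      rw [show ‖x‖ • c + x + (‖y‖ • c + y) = (‖x‖ + ‖y‖) • c + (x + y) by module] at n1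
      rw [show ‖x‖ • c - x + (‖y‖ • c - y) = (‖x‖ + ‖y‖) • c - (x + y) by module] at n2
      linarith)
    (by
      intro a x
      rcases le_total 0 a with ha | ha
      · rw [norm_smul, Real.norm_of_nonneg ha,
          show (a * ‖x‖) • c + a • x = a • (‖x‖ • c + x) by module,
          show (a * ‖x‖) • c - a • x = a • (‖x‖ • c - x) by module,
          norm_smul, norm_smul, Real.norm_of_nonneg ha]
        ring
      · rw [norm_smul, Real.norm_of_nonpos ha,
          show (-a * ‖x‖) • c + a • x = (-a) • (‖x‖ • c - x) by module,
          show (-a * ‖x‖) • c - a • x = (-a) • (‖x‖ • c + x) by module,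
          norm_smul, norm_smul, norm_neg, Real.norm_of_nonpos ha]
        ring)

theorem twistSeminorm_apply (c x : X) :
    twistSeminorm c x = ‖‖x‖ • c + x‖ + ‖‖x‖ • c - x‖ := rfl

theorem twistSeminorm_le (c x : X) : twistSeminorm c x ≤ 2 * (‖c‖ + 1) * ‖x‖ := by
  have n1 := norm_add_le (‖x‖ • c) x
  have n2 := norm_sub_le (‖x‖ • c) x
  rw [norm_smul, norm_norm] at n1 n2
  rw [twistSeminorm_apply]
  linarith

/-- The defect of additivity of a seminorm grows at most linearly with positive dilations. -/
theorem Seminorm.defect_smul_le (q : Seminorm ℝ X) {A B : ℝ} (hA : 0 ≤ A) (hB : 0 ≤ B) (x y : X) :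
    q (A • x) + q (B • y) - q (A • x + B • y) ≤ (A + B) * (q x + q y - q (x + y)) := by
  have hd : 0 ≤ q x + q y - q (x + y) := sub_nonneg.2 (map_add_le_add q x y)
  simp only [map_smul_eq_mul, Real.norm_of_nonneg hA, Real.norm_of_nonneg hB]
  rcases le_total A B with h | h
  · have h1 := map_add_le_add q (A • x + B • y) ((B - A) • x)
    rw [show A • x + B • y + (B - A) • x = B • (x + y) by module] at h1
    simp only [map_smul_eq_mul, Real.norm_of_nonneg hB, Real.norm_of_nonneg (sub_nonneg.2 h)] at h1
    nlinarith [mul_nonneg hA hd]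
  · have h1 := map_add_le_add q (A • x + B • y) ((A - B) • y)
    rw [show A • x + B • y + (A - B) • y = A • (x + y) by module] at h1
    simp only [map_smul_eq_mul, Real.norm_of_nonneg hA, Real.norm_of_nonneg (sub_nonneg.2 h)] at h1
    nlinarith [mul_nonneg hB hd]

theorem shifted_defect_le (c x y : X) (α β : ℝ) :
    ‖α • c + x‖ + ‖β • c + y‖ - ‖(α + β) • c + (x + y)‖ ≤
      (twistSeminorm c x + twistSeminorm c y - twistSeminorm c (x + y)) +
        2 * ‖c‖ * (‖x‖ + ‖y‖ - ‖x + y‖) + 2 * ‖c‖ * (|‖x‖ - α| + |‖y‖ - β|) := by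
  have key : ∀ (s t : ℝ) (z : X), ‖s • c + z‖ ≤ ‖t • c + z‖ + |s - t| * ‖c‖ := by
    intro s t z
    have h := norm_add_le (t • c + z) ((s - t) • c)
    rwa [show t • c + z + (s - t) • c = s • c + z by module, norm_smul, Real.norm_eq_abs] at h
  have hd : 0 ≤ ‖x‖ + ‖y‖ - ‖x + y‖ := sub_nonneg.2 (norm_add_le x y)
  have habs : |‖x + y‖ - (‖x‖ + ‖y‖)| = ‖x‖ + ‖y‖ - ‖x + y‖ := by
    rw [abs_sub_comm, abs_of_nonneg hd]
  have k1 := key ‖x + y‖ (‖x‖ + ‖y‖) (x + y)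
  have k2 := key ‖x + y‖ (‖x‖ + ‖y‖) (-(x + y))
  rw [habs] at k1 k2
  have k3 := norm_add_le (‖x‖ • c - x) (‖y‖ • c - y)
  rw [show ‖x‖ • c - x + (‖y‖ • c - y) = (‖x‖ + ‖y‖) • c + -(x + y) by module] at k3
  have k4 := key α ‖x‖ x
  have k5 := key β ‖y‖ y
  have k6 := key (‖x‖ + ‖y‖) (α + β) (x + y)
  have k7 : |‖x‖ + ‖y‖ - (α + β)| * ‖c‖ ≤ (|‖x‖ - α| + |‖y‖ - β|) * ‖c‖ := by
    refine mul_le_mul_of_nonneg_right ?_ (norm_nonneg c)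
    rw [show ‖x‖ + ‖y‖ - (α + β) = (‖x‖ - α) + (‖y‖ - β) by ring]
    exact abs_add_le _ _
  rw [abs_sub_comm] at k4 k5
  simp only [twistSeminorm_apply, sub_eq_add_neg _ (x + y)]
  linarith

/-- Changing the shift changes the defect in a Lipschitz way. -/
theorem shifted_defect_le_of_shift (c c' x y : X) {α β : ℝ} (hα : 0 ≤ α) (hβ : 0 ≤ β) :
    ‖α • c + x‖ + ‖β • c + y‖ - ‖(α + β) • c + (x + y)‖ ≤
      ‖α • c' + x‖ + ‖β • c' + y‖ - ‖(α + β) • c' + (x + y)‖ + 2 * (α + β) * ‖c - c'‖ := by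
  have key : ∀ (s : ℝ) (z w w' : X), 0 ≤ s → ‖s • w + z‖ ≤ ‖s • w' + z‖ + s * ‖w - w'‖ := by
    intro s z w w' hs
    have h := norm_add_le (s • w' + z) (s • (w - w'))
    rwa [show s • w' + z + s • (w - w') = s • w + z by module, norm_smul,
      Real.norm_of_nonneg hs] at h
  have k1 := key α x c c' hα
  have k2 := key β y c c' hβ
  have k3 := key (α + β) (x + y) c' c (add_nonneg hα hβ)
  rw [norm_sub_rev] at k3
  linarith

/-- If the norm and the twisted seminorms attached to a dense set of shifts are asymptotically
additive on `x m + y n`, then so are all shifted norms, with arbitrary positive weights. -/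
theorem eventually_shifted_defect_le {l : Filter ℕ} {x y : ℕ → X} {a b : ℝ}
    (ha : 0 < a) (hb : 0 < b)
    (hx : Tendsto (fun m => ‖x m‖) l (𝓝 a)) (hy : Tendsto (fun n => ‖y n‖) l (𝓝 b))
    (hnorm : Tendsto (fun p : ℕ × ℕ => ‖x p.1‖ + ‖y p.2‖ - ‖x p.1 + y p.2‖) (l.curry l) (𝓝 0))
    {c : ℕ → X} (hc : DenseRange c)
    (htw : ∀ k, Tendsto (fun p : ℕ × ℕ => twistSeminorm (c k) (x p.1) +
      twistSeminorm (c k) (y p.2) - twistSeminorm (c k) (x p.1 + y p.2)) (l.curry l) (𝓝 0))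
    (v : X) {α β : ℝ} (hα : 0 ≤ α) (hβ : 0 ≤ β) {ε : ℝ} (hε : 0 < ε) :
    ∀ᶠ p : ℕ × ℕ in l.curry l,
      ‖α • v + (α / a) • x p.1‖ + ‖β • v + (β / b) • y p.2‖ - ε ≤
        ‖(α + β) • v + ((α / a) • x p.1 + (β / b) • y p.2)‖ := by
  have hA : 0 ≤ α / a := by positivity
  have hB : 0 ≤ β / b := by positivity
  set A := α / a with hAdef
  set B := β / b with hBdef
  have hfst : Tendsto (fun p : ℕ × ℕ => p.1) (l.curry l) l := tendsto_fst.mono_left curry_le_prod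
  have hsnd : Tendsto (fun p : ℕ × ℕ => p.2) (l.curry l) l := tendsto_snd.mono_left curry_le_prod
  obtain ⟨k, hk⟩ : ∃ k, 2 * (α + β) * ‖v - c k‖ < ε / 2 := by
    have hpos : 0 < ε / 2 / (2 * (α + β) + 1) := by positivity
    obtain ⟨k, hk⟩ := hc.exists_dist_lt v hpos
    refine ⟨k, ?_⟩
    rw [dist_eq_norm, lt_div_iff₀ (by positivity)] at hk
    nlinarith [norm_nonneg (v - c k)]
  have hxA : Tendsto (fun p : ℕ × ℕ => |‖A • x p.1‖ - α|) (l.curry l) (𝓝 0) := by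
    have h := (((hx.comp hfst).const_mul A).sub_const α).abs
    have e : A * a - α = 0 := by rw [hAdef]; field_simp; simp
    simpa only [e, abs_zero, norm_smul, Real.norm_of_nonneg hA, Function.comp_def] using h
  have hyB : Tendsto (fun p : ℕ × ℕ => |‖B • y p.2‖ - β|) (l.curry l) (𝓝 0) := by
    have h := (((hy.comp hsnd).const_mul B).sub_const β).abs
    have e : B * b - β = 0 := by rw [hBdef]; field_simp; simp
    simpa only [e, abs_zero, norm_smul, Real.norm_of_nonneg hB, Function.comp_def] using h
  have hlim := (((htw k).const_mul (A + B)).add (hnorm.const_mul (2 * ‖c k‖ * (A + B)))).add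
    ((hxA.add hyB).const_mul (2 * ‖c k‖))
  simp only [mul_zero, add_zero] at hlim
  filter_upwards [hlim.eventually (gt_mem_nhds (half_pos hε))] with p hp
  have h1 := shifted_defect_le_of_shift v (c k) (A • x p.1) (B • y p.2) hα hβ
  have h2 := shifted_defect_le (c k) (A • x p.1) (B • y p.2) α β
  have h3 := (twistSeminorm (c k)).defect_smul_le hA hB (x p.1) (y p.2)
  have h4 := (normSeminorm ℝ X).defect_smul_le hA hB (x p.1) (y p.2)
  simp only [coe_normSeminorm] at h4
  have h5 := mul_le_mul_of_nonneg_left h4 (by positivity : 0 ≤ 2 * ‖c k‖)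
  linarith

/-- A pointwise asymptotic lower bound for an equi-Lipschitz family is uniform on compact sets. -/
theorem IsCompact.eventually_forall_sub_le {ι Z : Type*} [PseudoMetricSpace Z] {l : Filter ι}
    {K : Set Z} (hK : IsCompact K) {f : ι → Z → ℝ} {R : Z → ℝ} {C : ℝ}
    (hf : ∀ i z z', f i z ≤ f i z' + C * dist z z') (hR : ContinuousOn R K)
    (h : ∀ z ∈ K, ∀ ε > 0, ∀ᶠ i in l, R z - ε ≤ f i z) {ε : ℝ} (hε : 0 < ε) :
    ∀ᶠ i in l, ∀ z ∈ K, R z - ε ≤ f i z := by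
  refine hK.induction_on (p := fun S => ∀ᶠ i in l, ∀ z ∈ S, R z - ε ≤ f i z) (by simp)
    (fun s t hst ht => ht.mono fun i hi z hz => hi z (hst hz)) ?_ ?_
  · intro s t hs ht
    filter_upwards [hs, ht] with i h1 h2 z hz
    exact hz.elim (h1 z) (h2 z)
  · intro z hz
    have h1 : ∀ᶠ z' in 𝓝[K] z, R z' < R z + ε / 3 :=
      (hR z hz).eventually (gt_mem_nhds (by linarith))
    have hd : Tendsto (fun z' => C * dist z z') (𝓝[K] z) (𝓝 0) := by
      have : Continuous fun z' => C * dist z z' := by fun_prop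
      have h := this.continuousWithinAt (s := K) (x := z)
      rw [ContinuousWithinAt, dist_self, mul_zero] at h
      exact h
    have h2 : ∀ᶠ z' in 𝓝[K] z, C * dist z z' < ε / 3 :=
      hd.eventually (gt_mem_nhds (by linarith))
    refine ⟨_, h1.and h2, ?_⟩
    filter_upwards [h z hz (ε / 3) (by linarith)] with i hi z' hz'
    have := hf i z z'
    have := hz'.1
    have := hz'.2
    linarith

theorem Ultrafilter.exists_tendsto_of_abs_le {ι : Type*} (l : Ultrafilter ι) {f : ι → ℝ} {C : ℝ}
    (hf : ∀ i, |f i| ≤ C) : ∃ L, Tendsto f l (𝓝 L) := by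
  obtain ⟨L, -, hL⟩ := (isCompact_Icc (a := -C) (b := C)).ultrafilter_le_nhds (l.map f) (by
    rw [Filter.le_principal_iff]
    exact Filter.mem_map.2 (Filter.univ_mem' fun i => abs_le.1 (hf i)))
  exact ⟨L, hL⟩

/-- The compact sets `K k` of all combinations with coefficients in `[-1, 1]` of the vectors
`x (φ i (K i))`, `i < k`, each of which is chosen in terms of the set built before it. -/
noncomputable def spanBoxes (x : ℕ → X) (φ : ℕ → {K : Set X // IsCompact K} → ℕ) :
    ℕ → {K : Set X // IsCompact K}
  | 0 => ⟨{0}, isCompact_singleton⟩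
  | k + 1 =>
    ⟨(fun p : X × ℝ => p.1 + p.2 • x (φ k (spanBoxes x φ k))) ''
        ((spanBoxes x φ k).1 ×ˢ Set.Icc (-1) 1),
      ((spanBoxes x φ k).2.prod isCompact_Icc).image (by fun_prop)⟩

theorem sum_mem_spanBoxes (x : ℕ → X) (φ : ℕ → {K : Set X // IsCompact K} → ℕ) {a : ℕ → ℝ}
    {n : ℕ} (ha : ∀ i < n, |a i| ≤ 1) :
    ∑ i ∈ range n, a i • x (φ i (spanBoxes x φ i)) ∈ (spanBoxes x φ n).1 := by
  induction n with
  | zero => simp [spanBoxes]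
  | succ n ih =>
    rw [sum_range_succ]
    exact ⟨(_, a n), ⟨ih fun i hi => ha i (by omega), abs_le.1 (ha n (by omega))⟩, rfl⟩

/-- If adding `x m` to `u + s • y n` does not lower the norm more than a mixture does,
then some subsequence of `x` is equivalent to the unit vector basis of `ℓ₁`. -/
theorem exists_l1_sequence (l : Ultrafilter ℕ) {x y : ℕ → X} (hx : ∀ m, ‖x m‖ ≤ 2)
    (hy : ∀ n, ‖y n‖ ≤ 2) (hy1 : Tendsto (fun n => ‖y n‖) l (𝓝 1))
    (H : ∀ (u : X) (α β : ℝ), 0 < β → ∀ ε > 0, ∀ᶠ m in l, ∀ᶠ n in l,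
      |α| * (1 - ‖u‖ / (|α| + β)) + β / (|α| + β) * ‖u + (|α| + β) • y n‖ - ε ≤
        ‖u + α • x m + β • y n‖) :
    ∃ v : ℕ → X, ∃ A B : ℝ, 0 < A ∧ 0 < B ∧ ∀ (n : ℕ) (a : ℕ → ℝ),
      A⁻¹ * (∑ i ∈ range n, |a i|) ≤ ‖∑ i ∈ range n, a i • v i‖ ∧
        ‖∑ i ∈ range n, a i • v i‖ ≤ B * ∑ i ∈ range n, |a i| := by
  have hex : ∀ (u : X) (s : ℝ), ∃ L, Tendsto (fun n => ‖u + s • y n‖) l (𝓝 L) := fun u s =>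
    l.exists_tendsto_of_abs_le (C := ‖u‖ + |s| * 2) fun n => by
      rw [abs_norm]
      refine (norm_add_le _ _).trans ?_
      rw [norm_smul, Real.norm_eq_abs]
      gcongr
      exact hy n
  choose G hG using hex
  have hGlip : ∀ u u' s s', G u s ≤ G u' s' + (‖u - u'‖ + 2 * |s - s'|) := by
    intro u u' s s'
    refine le_of_tendsto_of_tendsto (hG u s) ((hG u' s').add_const _) (.of_forall fun n => ?_)
    have h1 := norm_add_le (u' + s' • y n) ((u - u') + (s - s') • y n)
    have h2 := norm_add_le (u - u') ((s - s') • y n)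
    rw [show u' + s' • y n + ((u - u') + (s - s') • y n) = u + s • y n by module] at h1
    rw [norm_smul, Real.norm_eq_abs] at h2
    have h3 := mul_le_mul_of_nonneg_left (hy n) (abs_nonneg (s - s'))
    dsimp only
    linarith
  have hGcont : Continuous fun p : X × ℝ => G p.1 p.2 := by
    refine (LipschitzWith.of_le_add_mul 3 fun p q => ?_).continuous
    have h := hGlip p.1 q.1 p.2 q.2
    have d1 : ‖p.1 - q.1‖ ≤ dist p q := by
      rw [← dist_eq_norm, Prod.dist_eq]; exact le_max_left _ _
    have d2 : |p.2 - q.2| ≤ dist p q := by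
      rw [← Real.dist_eq, Prod.dist_eq]; exact le_max_right _ _
    push_cast
    linarith
  have hG0 : ∀ s, 0 ≤ s → G 0 s = s := by
    intro s hs
    refine tendsto_nhds_unique (hG 0 s) ?_
    simpa [norm_smul, abs_of_nonneg hs] using hy1.const_mul s
  have hGle : ∀ u s, 0 ≤ s → G u s ≤ ‖u‖ + s := by
    intro u s hs
    refine le_of_tendsto_of_tendsto (hG u s) ((hy1.const_mul s).const_add ‖u‖ |>.congr fun n => rfl)
      (.of_forall fun n => ?_) |>.trans_eq (by rw [mul_one])
    refine (norm_add_le _ _).trans_eq ?_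
    rw [norm_smul, Real.norm_of_nonneg hs]
  have hstep : ∀ (k : ℕ) (K : {K : Set X // IsCompact K}), ∃ m, ∀ u ∈ K.1, ∀ α ∈ Set.Icc (-1 : ℝ) 1,
      ∀ β ∈ Set.Icc (5 : ℝ) 6, |α| * (1 - ‖u‖ / (|α| + β)) +
        β / (|α| + β) * G u (|α| + β) - (1 / 8) * (1 / 2) ^ k ≤ G (u + α • x m) β := by
    intro k K
    have hcomp : IsCompact (K.1 ×ˢ (Set.Icc (-1 : ℝ) 1 ×ˢ Set.Icc (5 : ℝ) 6)) :=
      K.2.prod (isCompact_Icc.prod isCompact_Icc)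
    have := hcomp.eventually_forall_sub_le (l := (l : Filter ℕ)) (C := 5)
      (f := fun m z => G (z.1 + z.2.1 • x m) z.2.2)
      (R := fun z => |z.2.1| * (1 - ‖z.1‖ / (|z.2.1| + z.2.2)) +
        z.2.2 / (|z.2.1| + z.2.2) * G z.1 (|z.2.1| + z.2.2)) ?_ ?_ ?_
      (ε := (1 / 8) * (1 / 2) ^ k) (by positivity)
    · obtain ⟨m, hm⟩ := this.exists
      exact ⟨m, fun u hu α hα β hβ => hm (u, α, β) ⟨hu, hα, hβ⟩⟩
    · intro m z z'
      have h1 := hGlip (z.1 + z.2.1 • x m) (z'.1 + z'.2.1 • x m) z.2.2 z'.2.2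
      have h2 := norm_add_le (z.1 - z'.1) ((z.2.1 - z'.2.1) • x m)
      rw [show z.1 - z'.1 + (z.2.1 - z'.2.1) • x m =
        z.1 + z.2.1 • x m - (z'.1 + z'.2.1 • x m) by module, norm_smul, Real.norm_eq_abs] at h2
      have h3 := mul_le_mul_of_nonneg_left (hx m) (abs_nonneg (z.2.1 - z'.2.1))
      have d1 : ‖z.1 - z'.1‖ ≤ dist z z' := by
        rw [← dist_eq_norm, Prod.dist_eq]; exact le_max_left _ _
      have d2 : |z.2.1 - z'.2.1| ≤ dist z z' := by
        rw [← Real.dist_eq, Prod.dist_eq, Prod.dist_eq (x := z.2)]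
        exact (le_max_left _ _).trans (le_max_right _ _)
      have d3 : |z.2.2 - z'.2.2| ≤ dist z z' := by
        rw [← Real.dist_eq, Prod.dist_eq, Prod.dist_eq (x := z.2)]
        exact (le_max_right _ _).trans (le_max_right _ _)
      linarith
    · have hne : ∀ z ∈ K.1 ×ˢ (Set.Icc (-1 : ℝ) 1 ×ˢ Set.Icc (5 : ℝ) 6), |z.2.1| + z.2.2 ≠ 0 := by
        intro z hz
        have := hz.2.2.1
        have := abs_nonneg z.2.1
        linarith
      have hc : Continuous fun z : X × ℝ × ℝ => G z.1 (|z.2.1| + z.2.2) :=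
        hGcont.comp (f := fun z : X × ℝ × ℝ => (z.1, |z.2.1| + z.2.2)) (by fun_prop)
      refine ContinuousOn.add (ContinuousOn.mul (by fun_prop) (ContinuousOn.sub (by fun_prop)
        (ContinuousOn.div (by fun_prop) (by fun_prop) hne))) (ContinuousOn.mul
        (ContinuousOn.div (by fun_prop) (by fun_prop) hne) hc.continuousOn)
    · intro z hz ε hε
      have hβ : 0 < z.2.2 := by linarith [hz.2.2.1]
      filter_upwards [H z.1 z.2.1 z.2.2 hβ ε hε] with m hm
      exact le_of_tendsto_of_tendsto
        ((((hG z.1 (|z.2.1| + z.2.2)).const_mul _).const_add _).sub_const ε)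
        (hG (z.1 + z.2.1 • x m) z.2.2) hm
  choose φ hφ using hstep
  set v : ℕ → X := fun i => x (φ i (spanBoxes x φ i)) with hv
  have hupper : ∀ (n : ℕ) (a : ℕ → ℝ),
      ‖∑ i ∈ range n, a i • v i‖ ≤ 2 * ∑ i ∈ range n, |a i| := by
    intro n a
    rw [mul_sum]
    refine norm_sum_le_of_le _ fun i _ => ?_
    rw [norm_smul, Real.norm_eq_abs, mul_comm]
    gcongr
    exact hx _
  have hlower : ∀ (n : ℕ) (a : ℕ → ℝ), ∑ i ∈ range n, |a i| = 1 →
      1 / 4 ≤ ‖∑ i ∈ range n, a i • v i‖ := by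
    intro n a ha
    have hle : ∀ j ≤ n, ∑ i ∈ range j, |a i| ≤ 1 := fun j hj => by
      rw [← ha]
      exact sum_le_sum_of_subset_of_nonneg (range_subset_range.2 hj) fun i _ _ => abs_nonneg _
    have hone : ∀ j < n, |a j| ≤ 1 := fun j hj =>
      (single_le_sum (fun i _ => abs_nonneg (a i)) (mem_range.2 hj)).trans ha.le
    have key : ∀ j ≤ n, 6 - (∑ i ∈ range j, |a i|) / 2 - (1 / 4 - 1 / 4 * (1 / 2) ^ j) ≤
        G (∑ i ∈ range j, a i • v i) (6 - ∑ i ∈ range j, |a i|) := by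
      intro j hj
      induction j with
      | zero => simp [hG0 6 (by norm_num)]
      | succ j ih =>
        have ih := ih (by omega)
        have hA1 := hle (j + 1) hj
        have hA0 := hle j (by omega)
        have hAnn : 0 ≤ ∑ i ∈ range j, |a i| := sum_nonneg fun i _ => abs_nonneg _
        have hu := hupper j a
        have hst := hφ j (spanBoxes x φ j) _
          (sum_mem_spanBoxes x φ (n := j) fun i hi => hone i (by omega)) (a j)
          (abs_le.1 (hone j (by omega))) (6 - ∑ i ∈ range (j + 1), |a i|)
          ⟨by linarith, by
            have : 0 ≤ ∑ i ∈ range (j + 1), |a i| := sum_nonneg fun i _ => abs_nonneg _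
            linarith⟩
        rw [sum_range_succ] at hst hA1
        rw [sum_range_succ, sum_range_succ]
        rw [show |a j| + (6 - (∑ i ∈ range j, |a i| + |a j|)) = 6 - ∑ i ∈ range j, |a i| by ring]
          at hst
        refine le_trans ?_ hst
        change _ ≤ |a j| * (1 - ‖∑ i ∈ range j, a i • v i‖ / (6 - ∑ i ∈ range j, |a i|)) +
          (6 - (∑ i ∈ range j, |a i| + |a j|)) / (6 - ∑ i ∈ range j, |a i|) *
            G (∑ i ∈ range j, a i • v i) (6 - ∑ i ∈ range j, |a i|) - 1 / 8 * (1 / 2) ^ j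
        generalize G (∑ i ∈ range j, a i • v i) (6 - ∑ i ∈ range j, |a i|) = g at ih ⊢
        generalize ‖∑ i ∈ range j, a i • v i‖ = w at hu ⊢
        have ht := abs_nonneg (a j)
        generalize |a j| = t at *
        generalize ∑ i ∈ range j, |a i| = S at *
        have he : (0 : ℝ) < (1 / 2) ^ j := by positivity
        have he1 : (1 / 2 : ℝ) ^ j ≤ 1 := pow_le_one₀ (by norm_num) (by norm_num)
        rw [pow_succ]
        generalize (1 / 2 : ℝ) ^ j = e at *
        have hs : 0 < 6 - S := by linarith
        have e1 : t * (1 - w / (6 - S)) + (6 - (S + t)) / (6 - S) * g =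
            t * (1 - w / (6 - S)) + (1 - t / (6 - S)) * g := by field_simp; ring
        have hq : t / (6 - S) ≤ t / 5 := by gcongr; linarith
        have hq0 : 0 ≤ t / (6 - S) := by positivity
        have hqt : t / (6 - S) * (6 - S) = t := by field_simp
        have e2 : t * (1 - w / (6 - S)) = t - t / (6 - S) * w := by ring
        rw [e1, e2]
        generalize t / (6 - S) = q at *
        nlinarith
    have h1 := key n le_rfl
    rw [ha] at h1
    have h2 := hGle (∑ i ∈ range n, a i • v i) (6 - 1) (by norm_num)
    have he : (0 : ℝ) < (1 / 2) ^ n := by positivity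
    have h3 := h1.trans h2
    linarith
  refine ⟨v, 4, 2, by norm_num, by norm_num, fun n a => ⟨?_, hupper n a⟩⟩
  have hS : 0 ≤ ∑ i ∈ range n, |a i| := sum_nonneg fun i _ => abs_nonneg _
  rcases hS.eq_or_lt with hS | hS
  · rw [← hS, mul_zero]
    exact norm_nonneg _
  · have h := hlower n (fun i => (∑ i ∈ range n, |a i|)⁻¹ * a i) (by
      simp only [abs_mul, ← mul_sum, abs_of_pos (inv_pos.2 hS)]
      exact inv_mul_cancel₀ hS.ne')
    simp only [mul_smul, ← smul_sum, norm_smul, Real.norm_of_nonneg (inv_pos.2 hS).le] at h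
    rw [← div_eq_inv_mul, le_div_iff₀ hS] at h
    linarith

theorem IterLim2.tendsto_curry_s19 {F : ℕ → ℕ → ℝ} {L : ℝ} (h : IterLim2 F L) {l : Filter ℕ}
    (hl : l ≤ atTop) : Tendsto (fun p : ℕ × ℕ => F p.1 p.2) (l.curry l) (𝓝 L) := by
  obtain ⟨g, hg, hgL⟩ := h
  intro s hs
  rw [Filter.mem_map, mem_curry_iff]
  filter_upwards [(hgL.mono_left hl).eventually (eventually_mem_nhds_iff.2 hs)] with m hm
  exact (hg m).mono_left hl hm

theorem IsSchauderBasis.separableSpace {b : ℕ → X} (hb : IsSchauderBasis b) :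
    TopologicalSpace.SeparableSpace X := by
  rw [← TopologicalSpace.isSeparable_univ_iff, ← hb.2.closure_eq]
  exact ((Set.countable_range b).isSeparable.span (R := ℝ)).closure

/-- The weight of the `k`-th twisted seminorm in the renorming. -/
noncomputable def twistWeight {Y : Type*} [NormedAddCommGroup Y] (c : ℕ → Y) (k : ℕ) : ℝ := (1 / 2) ^ (k + 2) / (‖c k‖ + 1)

theorem twistWeight_pos {Y : Type*} [NormedAddCommGroup Y] (c : ℕ → Y) (k : ℕ) : 0 < twistWeight c k := by
  unfold twistWeight; positivity

theorem twistWeight_mul_le (c : ℕ → X) (k : ℕ) (x : X) :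
    twistWeight c k * twistSeminorm (c k) x ≤ 1 / 2 / 2 ^ k * ‖x‖ := by
  refine (mul_le_mul_of_nonneg_left (twistSeminorm_le (c k) x) (twistWeight_pos c k).le).trans_eq ?_
  have : ‖c k‖ + 1 ≠ 0 := by positivity
  unfold twistWeight
  rw [one_div_pow]
  field_simp
  ring

theorem summable_twist (c : ℕ → X) (x : X) :
    Summable fun k => twistWeight c k * twistSeminorm (c k) x :=
  Summable.of_nonneg_of_le (fun k => mul_nonneg (twistWeight_pos c k).le (apply_nonneg _ x))
    (fun k => twistWeight_mul_le c k x) ((summable_geometric_two' 1).mul_right _)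

theorem tsum_twist_le (c : ℕ → X) (x : X) :
    ∑' k, twistWeight c k * twistSeminorm (c k) x ≤ ‖x‖ := by
  have h := (summable_twist c x).tsum_le_tsum (fun k => twistWeight_mul_le c k x)
    ((summable_geometric_two' 1).mul_right _)
  rwa [tsum_mul_right, tsum_geometric_two', one_mul] at h

/-- The renorming `x ↦ ‖x‖ + ∑ₖ wₖ (‖‖x‖ • cₖ + x‖ + ‖‖x‖ • cₖ - x‖)`. -/
noncomputable def twistedNorm (c : ℕ → X) : EquivNorm X where
  toFun x := ‖x‖ + ∑' k, twistWeight c k * twistSeminorm (c k) x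
  add_le' x y := by
    have h : ∑' k, twistWeight c k * twistSeminorm (c k) (x + y) ≤
        ∑' k, (twistWeight c k * twistSeminorm (c k) x +
          twistWeight c k * twistSeminorm (c k) y) := by
      refine (summable_twist c _).tsum_le_tsum (fun k => ?_)
        ((summable_twist c x).add (summable_twist c y))
      rw [← mul_add]
      exact mul_le_mul_of_nonneg_left (map_add_le_add _ x y) (twistWeight_pos c k).le
    rw [(summable_twist c x).tsum_add (summable_twist c y)] at h
    linarith [norm_add_le x y]
  smul' a x := by
    simp only [norm_smul, map_smul_eq_mul, Real.norm_eq_abs, mul_left_comm _ |a|, tsum_mul_left,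
      mul_add]
  lower' := ⟨1, one_pos, fun x => by
    rw [one_mul]
    exact le_add_of_nonneg_right
      (tsum_nonneg fun k => mul_nonneg (twistWeight_pos c k).le (apply_nonneg _ x))⟩
  upper' := ⟨2, two_pos, fun x => by linarith [tsum_twist_le c x]⟩

theorem twistedNorm_apply (c : ℕ → X) (x : X) :
    (twistedNorm c).toFun x = ‖x‖ + ∑' k, twistWeight c k * twistSeminorm (c k) x := rfl

theorem norm_le_twistedNorm (c : ℕ → X) (x : X) : ‖x‖ ≤ (twistedNorm c).toFun x :=
  le_add_of_nonneg_right
    (tsum_nonneg fun k => mul_nonneg (twistWeight_pos c k).le (apply_nonneg _ x))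

theorem twistedNorm_le (c : ℕ → X) (x : X) : (twistedNorm c).toFun x ≤ 2 * ‖x‖ := by
  rw [twistedNorm_apply]
  linarith [tsum_twist_le c x]

theorem twistedNorm_neg (c : ℕ → X) (x : X) :
    (twistedNorm c).toFun (-x) = (twistedNorm c).toFun x := by
  simp [twistedNorm_apply, map_neg_eq_map]

/-- The defect of additivity of the renorming dominates the weighted defects of its summands. -/
theorem defect_add_defect_le (c : ℕ → X) (k : ℕ) (x y : X) :
    (‖x‖ + ‖y‖ - ‖x + y‖) + twistWeight c k *
      (twistSeminorm (c k) x + twistSeminorm (c k) y - twistSeminorm (c k) (x + y)) ≤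
      (twistedNorm c).toFun x + (twistedNorm c).toFun y - (twistedNorm c).toFun (x + y) := by
  have hs := ((summable_twist c x).add (summable_twist c y)).sub (summable_twist c (x + y))
  have h := hs.le_tsum k (fun j _ => by
    rw [← mul_add, ← mul_sub]
    exact mul_nonneg (twistWeight_pos c j).le (sub_nonneg.2 (map_add_le_add _ x y)))
  rw [((summable_twist c x).add (summable_twist c y)).tsum_sub (summable_twist c (x + y)),
    (summable_twist c x).tsum_add (summable_twist c y)] at h
  simp only [twistedNorm_apply]
  linarith

/-- If the renorming is asymptotically additive on `x m + y n`, then so are all shifts of the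
original norm. -/
theorem eventually_shifted_defect_le_of_twistedNorm {c : ℕ → X} (hc : DenseRange c)
    {l : Filter ℕ} {x y : ℕ → X} {a b : ℝ} (ha : 0 < a) (hb : 0 < b)
    (hxN : NormalizedW (twistedNorm c).toFun x) (hyN : NormalizedW (twistedNorm c).toFun y)
    (hx : Tendsto (fun m => ‖x m‖) l (𝓝 a)) (hy : Tendsto (fun n => ‖y n‖) l (𝓝 b))
    (h : Tendsto (fun p : ℕ × ℕ => (twistedNorm c).toFun (x p.1 + y p.2)) (l.curry l) (𝓝 2))
    (v : X) {α β : ℝ} (hα : 0 ≤ α) (hβ : 0 ≤ β) {ε : ℝ} (hε : 0 < ε) :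
    ∀ᶠ p : ℕ × ℕ in l.curry l,
      ‖α • v + (α / a) • x p.1‖ + ‖β • v + (β / b) • y p.2‖ - ε ≤
        ‖(α + β) • v + ((α / a) • x p.1 + (β / b) • y p.2)‖ := by
  have hd : Tendsto (fun p : ℕ × ℕ => 2 - (twistedNorm c).toFun (x p.1 + y p.2))
      (l.curry l) (𝓝 0) := by
    simpa using h.const_sub 2
  have hsum : ∀ m n, (twistedNorm c).toFun (x m) + (twistedNorm c).toFun (y n) = 2 := fun m n => by
    rw [hxN, hyN]; norm_num
  have hn0 : ∀ p : ℕ × ℕ, 0 ≤ ‖x p.1‖ + ‖y p.2‖ - ‖x p.1 + y p.2‖ := fun p =>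
    sub_nonneg.2 (norm_add_le _ _)
  have hq0 : ∀ k (p : ℕ × ℕ), 0 ≤ twistSeminorm (c k) (x p.1) +
      twistSeminorm (c k) (y p.2) - twistSeminorm (c k) (x p.1 + y p.2) := fun k p =>
    sub_nonneg.2 (map_add_le_add _ _ _)
  refine eventually_shifted_defect_le ha hb hx hy ?_ hc (fun k => ?_) v hα hβ hε
  · refine squeeze_zero hn0 (fun p => ?_) hd
    have h1 := defect_add_defect_le c 0 (x p.1) (y p.2)
    rw [hsum] at h1
    linarith [mul_nonneg (twistWeight_pos c 0).le (hq0 0 p)]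
  · have hd' := hd.const_mul (twistWeight c k)⁻¹
    rw [mul_zero] at hd'
    refine squeeze_zero (hq0 k) (fun p => ?_) hd'
    have h1 := defect_add_defect_le c k (x p.1) (y p.2)
    rw [hsum] at h1
    rw [inv_mul_eq_div, le_div_iff₀' (twistWeight_pos c k)]
    linarith [hn0 p]

theorem le_norm_add_of_shifted_defect_le {x y u : X} {α β ε : ℝ} (hα : 0 ≤ α) (hβ : 0 < β)
    (h : ‖α • ((α + β)⁻¹ • u) + α • x‖ + ‖β • ((α + β)⁻¹ • u) + β • y‖ - ε ≤
      ‖(α + β) • ((α + β)⁻¹ • u) + (α • x + β • y)‖) :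
    α * (‖x‖ - ‖u‖ / (α + β)) + β / (α + β) * ‖u + (α + β) • y‖ - ε ≤
      ‖u + α • x + β • y‖ := by
  have hs : 0 < α + β := by linarith
  have e1 : (α + β) • ((α + β)⁻¹ • u) + (α • x + β • y) = u + α • x + β • y := by
    rw [smul_inv_smul₀ hs.ne', add_assoc]
  have e2 : β • ((α + β)⁻¹ • u) + β • y = (β / (α + β)) • (u + (α + β) • y) := by
    rw [smul_add, smul_smul, smul_smul, div_mul_cancel₀ _ hs.ne', div_eq_mul_inv]
  have e3 := norm_sub_le (α • ((α + β)⁻¹ • u) + α • x) (α • ((α + β)⁻¹ • u))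
  rw [add_sub_cancel_left, norm_smul, norm_smul, norm_smul, Real.norm_of_nonneg hα,
    Real.norm_of_nonneg (inv_pos.2 hs).le] at e3
  rw [e1, e2, norm_smul, Real.norm_of_nonneg (by positivity : 0 ≤ β / (α + β))] at h
  have e4 : ‖u‖ / (α + β) = (α + β)⁻¹ * ‖u‖ := by rw [div_eq_inv_mul]
  rw [e4, mul_sub]
  linarith

/-- Theorem 4.8: if `X` has a basis `b`, there is an equivalent norm `N` on `X` so that if
there are `N`-normalized block bases `x`, `y` of `b` with
`lim_m lim_n N (x m ± y n) = 2`, then `X` contains an isomorphic copy of `ℓ₁`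
(a sequence equivalent to the unit vector basis of `ℓ₁`). -/
theorem stmt_19 {X : Type*} [NormedAddCommGroup X] [NormedSpace ℝ X] [CompleteSpace X]
    (b : ℕ → X) (hb : IsSchauderBasis b) :
    ∃ N : EquivNorm X,
      ∀ x y : ℕ → X, IsBlockBasisOf b x → IsBlockBasisOf b y →
        NormalizedW N.toFun x → NormalizedW N.toFun y →
        IterLim2 (fun m n => N.toFun (x m + y n)) 2 →
        IterLim2 (fun m n => N.toFun (x m - y n)) 2 →
        ∃ u : ℕ → X, ∃ A B : ℝ, 0 < A ∧ 0 < B ∧ ∀ (n : ℕ) (a : ℕ → ℝ),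
          A⁻¹ * (∑ i ∈ Finset.range n, |a i|) ≤ ‖∑ i ∈ Finset.range n, a i • u i‖ ∧
            ‖∑ i ∈ Finset.range n, a i • u i‖ ≤ B * ∑ i ∈ Finset.range n, |a i| := by
  have := hb.separableSpace
  set c := TopologicalSpace.denseSeq X
  have hc : DenseRange c := TopologicalSpace.denseRange_denseSeq X
  refine ⟨twistedNorm c, fun x y _ _ hx hy hadd hsub => ?_⟩
  let l : Ultrafilter ℕ := hyperfilter ℕ
  have hl : (l : Filter ℕ) ≤ atTop := Nat.hyperfilter_le_atTop
  have bound : ∀ z : ℕ → X, NormalizedW (twistedNorm c).toFun z →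
      (∀ n, 1 / 2 ≤ ‖z n‖ ∧ ‖z n‖ ≤ 1) ∧
        ∃ r, 1 / 2 ≤ r ∧ Tendsto (fun n => ‖z n‖) l (𝓝 r) := by
    intro z hz
    have h1 : ∀ n, 1 / 2 ≤ ‖z n‖ ∧ ‖z n‖ ≤ 1 := fun n => by
      have h2 := twistedNorm_le c (z n)
      have h3 := norm_le_twistedNorm c (z n)
      rw [hz] at h2 h3
      exact ⟨by linarith, h3⟩
    obtain ⟨r, hr⟩ := l.exists_tendsto_of_abs_le (f := fun n => ‖z n‖) (C := 1) fun n => by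
      rw [abs_norm]; exact (h1 n).2
    exact ⟨h1, r, ge_of_tendsto' hr fun n => (h1 n).1, hr⟩
  obtain ⟨hxb, r, hr, hxr⟩ := bound x hx
  obtain ⟨hyb, s, hs, hys⟩ := bound y hy
  have hr0 : 0 < r := by linarith
  have hs0 : 0 < s := by linarith
  have scaled : ∀ {z : ℕ → X} {t : ℝ}, 1 / 2 ≤ t → (∀ n, 1 / 2 ≤ ‖z n‖ ∧ ‖z n‖ ≤ 1) →
      ∀ n, ‖t⁻¹ • z n‖ ≤ 2 := fun {z t} ht hz n => by
    have ht0 : 0 < t := by linarith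
    rw [norm_smul, Real.norm_of_nonneg (inv_pos.2 ht0).le, inv_mul_eq_div, div_le_iff₀ ht0]
    linarith [(hz n).2]
  have scaled_lim : ∀ {z : ℕ → X} {t : ℝ}, 0 < t → Tendsto (fun n => ‖z n‖) l (𝓝 t) →
      Tendsto (fun n => ‖t⁻¹ • z n‖) l (𝓝 1) := fun {z t} ht hz => by
    simpa [norm_smul, abs_of_pos ht, ht.ne'] using hz.const_mul t⁻¹
  refine exists_l1_sequence l (x := fun m => r⁻¹ • x m) (y := fun n => s⁻¹ • y n)
    (scaled hr hxb) (scaled hs hyb) (scaled_lim hs0 hys) ?_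
  -- the case of nonnegative coefficients, for either choice of sign in front of `y`
  have pos : ∀ y' : ℕ → X, NormalizedW (twistedNorm c).toFun y' →
      Tendsto (fun n => ‖y' n‖) l (𝓝 s) →
      IterLim2 (fun m n => (twistedNorm c).toFun (x m + y' n)) 2 →
      ∀ (u : X) (α β : ℝ), 0 ≤ α → 0 < β → ∀ ε > 0, ∀ᶠ m in l, ∀ᶠ n in l,
        α * (1 - ‖u‖ / (α + β)) + β / (α + β) * ‖u + (α + β) • s⁻¹ • y' n‖ - ε ≤
          ‖u + α • r⁻¹ • x m + β • s⁻¹ • y' n‖ := by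
    intro y' hy' hy's hlim u α β hα hβ ε hε
    have h := eventually_shifted_defect_le_of_twistedNorm hc hr0 hs0 hx hy' hxr hy's
      (hlim.tendsto_curry_s19 hl) ((α + β)⁻¹ • u) hα hβ.le (half_pos hε)
    have hδ : 0 < ε / 2 / (α + 1) := by positivity
    filter_upwards [h, (scaled_lim hr0 hxr).eventually
      (lt_mem_nhds (show 1 - ε / 2 / (α + 1) < 1 by linarith))] with m hm hxm
    filter_upwards [hm] with n hn
    simp only [div_eq_mul_inv α r, div_eq_mul_inv β s, mul_smul] at hn
    have h1 := le_norm_add_of_shifted_defect_le hα hβ hn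
    have h2 := mul_le_mul_of_nonneg_left hxm.le hα
    have h3 : α * (ε / 2 / (α + 1)) ≤ ε / 2 := by
      rw [mul_div_assoc', div_le_iff₀ (by linarith)]
      nlinarith
    linarith
  intro u α β hβ ε hε
  rcases le_total 0 α with hα | hα
  · rw [abs_of_nonneg hα]
    exact pos y hy hys hadd u α β hα hβ ε hε
  · rw [abs_of_nonpos hα]
    have hyn : NormalizedW (twistedNorm c).toFun fun n => -y n := fun n => by
      rw [twistedNorm_neg, hy]
    have h := pos (fun n => -y n) hyn (by simpa using hys)
      (by simpa only [sub_eq_add_neg] using hsub) (-u) (-α) β (by linarith) hβ ε hε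
    filter_upwards [h] with m hm
    filter_upwards [hm] with n hn
    rw [norm_neg, show -u + (-α + β) • s⁻¹ • -y n = -(u + (-α + β) • s⁻¹ • y n) by module,
      show -u + (-α) • r⁻¹ • x m + β • s⁻¹ • -y n = -(u + α • r⁻¹ • x m + β • s⁻¹ • y n) by module,
      norm_neg, norm_neg] at hn
    exact hn
end
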